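/- arXiv:1709.05287 — 3 statements merged into one kernel-verified Lean document; each statement's English description precedes it below -/
import Mathlib

section
/- Let ρ ≥ 1 and let μ, ν ∈ P_ρ(ℝ^d). Then the infimum of J_ρ(R) = ∫ |x − m_R(x)|^ρ μ(dx) over all Markov kernels R on ℝ^d with μR = ν equals the infimum of W_ρ(μ,η)^ρ over all probability measures η on ℝ^d with η ≤cx ν, and both infima are attained. -/
open MeasureTheory ProbabilityTheory Set
open scoped ENNReal

noncomputable section

/-- `μ ≤cx ν`: convex order between measures on a normed space. -/
def ConvexOrder {E : Type*} [NormedAddCommGroup E] [NormedSpace ℝ E] [MeasurableSpace E]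
    (μ ν : Measure E) : Prop :=
  (∀ φ : E → ℝ, ConvexOn ℝ univ φ → (∀ x, 0 ≤ φ x) →
      ∫⁻ x, ENNReal.ofReal (φ x) ∂μ ≤ ∫⁻ x, ENNReal.ofReal (φ x) ∂ν) ∧
  (∀ φ : E → ℝ, ConvexOn ℝ univ φ → Integrable φ (μ + ν) →
      ∫ x, φ x ∂μ ≤ ∫ x, φ x ∂ν)

/-- `Wp ρ μ ν` is the ρ-th power `W_ρ(μ,ν)^ρ` of the ρ-Wasserstein distance. -/
def Wp {E : Type*} [NormedAddCommGroup E] [MeasurableSpace E]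
    (ρ : ℝ) (μ ν : Measure E) : ℝ≥0∞ :=
  ⨅ (π : Measure (E × E)) (_ : π.map Prod.fst = μ) (_ : π.map Prod.snd = ν),
    ∫⁻ p, ENNReal.ofReal (‖p.1 - p.2‖ ^ ρ) ∂π

/-- Positive extension of a functional from the range of a linear map into functions. -/
lemma pos_ext {X Q : Type*} [AddCommGroup Q] [Module ℝ Q]
    (T : Q →ₗ[ℝ] (X → ℝ)) (l : Q →ₗ[ℝ] ℝ)
    (hpos : ∀ q, (∀ p, 0 ≤ T q p) → 0 ≤ l q)
    (hdom : ∀ q, ∃ q', ∀ p, |T q p| ≤ T q' p) :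
    ∃ L : (X → ℝ) →ₗ[ℝ] ℝ, (∀ q, L (T q) = l q) ∧
      ∀ F : X → ℝ, (∀ p, 0 ≤ F p) → (∃ q, ∀ p, F p ≤ T q p) → 0 ≤ L F := by
  let V : Submodule ℝ (X → ℝ) :=
    { carrier := {F | ∃ q, ∀ p, |F p| ≤ T q p}
      add_mem' := by
        rintro F G ⟨q, hq⟩ ⟨r, hr⟩
        refine ⟨q + r, fun p => ?_⟩
        rw [map_add]
        exact (abs_add_le _ _).trans (add_le_add (hq p) (hr p))
      zero_mem' := ⟨0, fun p => by simp⟩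
      smul_mem' := by
        rintro c F ⟨q, hq⟩
        refine ⟨|c| • q, fun p => ?_⟩
        rw [map_smul]
        simp only [Pi.smul_apply, smul_eq_mul, abs_mul]
        exact mul_le_mul_of_nonneg_left (hq p) (abs_nonneg c) }
  let T' : Q →ₗ[ℝ] V := T.codRestrict V hdom
  have hker : LinearMap.ker T' ≤ LinearMap.ker l := by
    intro q hq
    have h0 : T q = 0 := by
      have := congrArg Subtype.val (LinearMap.mem_ker.mp hq)
      simpa [T'] using this
    have h1 : 0 ≤ l q := hpos q (fun p => by simp [h0])
    have h2 : 0 ≤ l (-q) := hpos (-q) (fun p => by simp [h0])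
    rw [map_neg] at h2
    exact LinearMap.mem_ker.mpr (by linarith)
  let f0 : LinearMap.range T' →ₗ[ℝ] ℝ :=
    ((LinearMap.ker T').liftQ l hker).comp (T'.quotKerEquivRange.symm : _ →ₗ[ℝ] _)
  have hf0 : ∀ q (h : T' q ∈ LinearMap.range T'), f0 ⟨T' q, h⟩ = l q := by
    intro q h
    simp only [f0, LinearMap.comp_apply, LinearEquiv.coe_coe]
    rw [LinearMap.quotKerEquivRange_symm_apply_image]
    simp
  let s : PointedCone ℝ V :=
    { carrier := {F | ∀ p, 0 ≤ (F : X → ℝ) p}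
      add_mem' := fun {F G} hF hG p => add_nonneg (hF p) (hG p)
      zero_mem' := fun p => le_rfl
      smul_mem' := fun c F hF p => mul_nonneg c.2 (hF p) }
  obtain ⟨g, hg1, hg2⟩ := riesz_extension s ⟨LinearMap.range T', f0⟩
    (by
      rintro ⟨_, q, rfl⟩ hx
      exact (hpos q hx).trans_eq (hf0 q ⟨q, rfl⟩).symm)
    (by
      rintro ⟨F, q, hq⟩
      refine ⟨⟨T' q, q, rfl⟩, fun p => ?_⟩
      have := hq p
      change 0 ≤ T q p + F p
      linarith [neg_abs_le (F p)])
  obtain ⟨L, hL⟩ := g.exists_extend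
  have hL' : ∀ F : V, L F = g F := fun F => by rw [← hL]; rfl
  refine ⟨L, fun q => ?_, fun F hF ⟨q, hq⟩ => ?_⟩
  · rw [← hf0 q ⟨q, rfl⟩]
    exact (hL' (T' q)).trans (hg1 ⟨T' q, q, rfl⟩)
  · have hFV : F ∈ V := ⟨q, fun p => by rw [abs_of_nonneg (hF p)]; exact hq p⟩
    have := hg2 ⟨F, hFV⟩ hF
    rwa [← hL'] at this

lemma norm_le_one_add_rpow {ρ : ℝ} (hρ : 1 ≤ ρ) {a : ℝ} (ha : 0 ≤ a) : a ≤ 1 + a ^ ρ := by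
  rcases le_total a 1 with h | h
  · have := Real.rpow_nonneg ha ρ
    linarith
  · have := Real.self_le_rpow_of_one_le h hρ
    linarith

lemma integrable_norm_of_rpow {E : Type*} [NormedAddCommGroup E] [MeasurableSpace E]
    [BorelSpace E] [SecondCountableTopology E]
    {ρ : ℝ} (hρ : 1 ≤ ρ) {μ : Measure E} [IsFiniteMeasure μ]
    (h : Integrable (fun x => ‖x‖ ^ ρ) μ) : Integrable (fun x : E => ‖x‖) μ := by
  refine ((integrable_const (1 : ℝ)).add h).mono' (by fun_prop) (.of_forall fun x => ?_)
  simpa using norm_le_one_add_rpow hρ (norm_nonneg x)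

lemma convexOn_norm_rpow {E : Type*} [NormedAddCommGroup E] [NormedSpace ℝ E]
    {ρ : ℝ} (hρ : 1 ≤ ρ) (x : E) : ConvexOn ℝ univ (fun w : E => ‖x - w‖ ^ ρ) := by
  refine ⟨convex_univ, fun a _ b _ s t hs ht hst => ?_⟩
  have h1 : ‖x - (s • a + t • b)‖ ≤ s * ‖x - a‖ + t * ‖x - b‖ := by
    have : x - (s • a + t • b) = s • (x - a) + t • (x - b) := by
      have : x = (s + t) • x := by rw [hst, one_smul]
      nth_rw 1 [this]
      module
    rw [this]
    refine (norm_add_le _ _).trans ?_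
    rw [norm_smul, norm_smul, Real.norm_of_nonneg hs, Real.norm_of_nonneg ht]
  refine (Real.rpow_le_rpow (norm_nonneg _) h1 (by linarith)).trans ?_
  exact (convexOn_rpow hρ).2 (norm_nonneg _) (norm_nonneg _) hs ht hst

lemma convexOn_continuous {E : Type*} [NormedAddCommGroup E] [NormedSpace ℝ E]
    [FiniteDimensional ℝ E] {φ : E → ℝ} (h : ConvexOn ℝ univ φ) : Continuous φ := by
  rw [← continuousOn_univ]
  exact h.continuousOn isOpen_univ

/-- Jensen with extended values. -/
lemma jensen_lintegral {E : Type*} [NormedAddCommGroup E] [NormedSpace ℝ E]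
    [FiniteDimensional ℝ E] [MeasurableSpace E] [BorelSpace E] {Ω : Type*} [MeasurableSpace Ω]
    (m : Measure Ω) [IsProbabilityMeasure m] {u : Ω → E} (hu : Integrable u m)
    {φ : E → ℝ} (hφ : ConvexOn ℝ univ φ) (h0 : ∀ x, 0 ≤ φ x) :
    ENNReal.ofReal (φ (∫ w, u w ∂m)) ≤ ∫⁻ w, ENNReal.ofReal (φ (u w)) ∂m := by
  have hc := convexOn_continuous hφ
  by_cases hi : Integrable (fun w => φ (u w)) m
  · rw [← ofReal_integral_eq_lintegral_ofReal hi (.of_forall fun w => h0 _)]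
    exact ENNReal.ofReal_le_ofReal
      (hφ.map_integral_le hc.continuousOn isClosed_univ (.of_forall fun _ => mem_univ _) hu hi)
  · have hm : AEStronglyMeasurable (fun w => φ (u w)) m := hc.comp_aestronglyMeasurable hu.1
    have : ∫⁻ w, ENNReal.ofReal (φ (u w)) ∂m = ∞ := by
      by_contra hne
      exact hi ((lintegral_ofReal_ne_top_iff_integrable hm (.of_forall fun w => h0 _)).mp hne)
    rw [this]
    exact le_top

section core

variable {E : Type*} [NormedAddCommGroup E] [InnerProductSpace ℝ E] [FiniteDimensional ℝ E]
  [MeasurableSpace E] [BorelSpace E]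

lemma weak_pos {ρ : ℝ} {μ ν η : Measure E} [IsProbabilityMeasure μ] [IsProbabilityMeasure ν]
    [IsProbabilityMeasure η] (hν1 : Integrable (fun y : E => ‖y‖) ν)
    {f g : E → ℝ} {h : E × E → E} {t : ℝ} (hf : Integrable f μ) (hg : Integrable g ν)
    (H : ∀ x z y, 0 ≤ f x + g y + inner ℝ (h (x, z)) (y - z) + t * ‖x - z‖ ^ ρ)
    (hη : ConvexOrder η ν) {π : Measure (E × E)} (h1 : π.map Prod.fst = μ)
    (h2 : π.map Prod.snd = η) (hc : Integrable (fun p : E × E => ‖p.1 - p.2‖ ^ ρ) π) :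
    0 ≤ ∫ x, f x ∂μ + ∫ y, g y ∂ν + t * ∫ p, ‖p.1 - p.2‖ ^ ρ ∂π := by
  let A : E × E → E → ℝ := fun p y =>
    -f p.1 - t * ‖p.1 - p.2‖ ^ ρ - inner ℝ (h p) (y - p.2)
  have hAg : ∀ p y, A p y ≤ g y := by
    rintro ⟨x, z⟩ y
    have := H x z y
    simp only [A]
    linarith
  have hbdd : ∀ y, BddAbove (range fun p => A p y) := by
    rintro y
    refine ⟨g y, ?_⟩
    rintro _ ⟨p, rfl⟩
    exact hAg p y
  let φ : E → ℝ := fun y => ⨆ p, A p y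
  have hAφ : ∀ p y, A p y ≤ φ y := fun p y => le_ciSup (hbdd y) p
  have hφg : ∀ y, φ y ≤ g y := fun y => ciSup_le fun p => hAg p y
  have hφ : ConvexOn ℝ univ φ := by
    refine ⟨convex_univ, fun a _ b _ s u hs hu hsu => ciSup_le fun p => ?_⟩
    have e : A p (s • a + u • b) = s * A p a + u * A p b := by
      simp only [A, inner_sub_right, inner_add_right, inner_smul_right]
      have : u = 1 - s := by linarith
      subst this
      ring
    rw [e]
    exact add_le_add (mul_le_mul_of_nonneg_left (hAφ p a) hs)
      (mul_le_mul_of_nonneg_left (hAφ p b) hu)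
  have hφc := convexOn_continuous hφ
  -- first moments
  have hη1 : Integrable (fun y : E => ‖y‖) η := by
    have := hη.1 (fun y => ‖y‖) convexOn_univ_norm (fun y => norm_nonneg y)
    refine (lintegral_ofReal_ne_top_iff_integrable (by fun_prop)
      (.of_forall fun w => norm_nonneg w)).mp (ne_top_of_le_ne_top ?_ this)
    exact (lintegral_ofReal_ne_top_iff_integrable (by fun_prop)
      (.of_forall fun w => norm_nonneg w)).mpr hν1
  let a : E → ℝ := A (0, 0)
  have haint : ∀ m : Measure E, IsProbabilityMeasure m → Integrable (fun y : E => ‖y‖) m →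
      Integrable a m := by
    intro m _ hm
    have hid : Integrable (fun y : E => y) m := (integrable_norm_iff (by fun_prop)).mp hm
    simp only [a, A, sub_zero]
    exact (integrable_const _).sub (hid.const_inner (h (0, 0)))
  have hφν : Integrable φ ν := by
    refine ((haint ν inferInstance hν1).norm.add hg.norm).mono' hφc.aestronglyMeasurable
      (.of_forall fun y => ?_)
    have h3 : a y ≤ φ y := hAφ (0, 0) y
    have h4 := hφg y
    simp only [Pi.add_apply, Real.norm_eq_abs]
    rw [abs_le]
    constructor
    · linarith [neg_abs_le (a y), abs_nonneg (g y)]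
    · linarith [le_abs_self (g y), abs_nonneg (a y)]
  have hψ : ConvexOn ℝ univ (fun y => φ y - a y) := by
    refine ⟨convex_univ, fun x _ y _ s u hs hu hsu => ?_⟩
    have := hφ.2 (mem_univ x) (mem_univ y) hs hu hsu
    have e : a (s • x + u • y) = s * a x + u * a y := by
      simp only [a, A, inner_sub_right, inner_add_right, inner_smul_right]
      have : u = 1 - s := by linarith
      subst this
      ring
    simp only [smul_eq_mul] at this ⊢
    rw [e]
    linarith
  have hψ0 : ∀ y, 0 ≤ φ y - a y := fun y => sub_nonneg.mpr (hAφ (0, 0) y)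
  have hψη : Integrable (fun y => φ y - a y) η := by
    have hm := (convexOn_continuous hψ).measurable.aestronglyMeasurable (μ := η)
    have hm' := (convexOn_continuous hψ).measurable.aestronglyMeasurable (μ := ν)
    refine (lintegral_ofReal_ne_top_iff_integrable hm (.of_forall hψ0)).mp
      (ne_top_of_le_ne_top ?_ (hη.1 _ hψ hψ0))
    exact (lintegral_ofReal_ne_top_iff_integrable hm' (.of_forall hψ0)).mpr
      (hφν.sub (haint ν inferInstance hν1))
  have hφη : Integrable φ η := by
    have := hψη.add (haint η inferInstance hη1)
    refine this.congr (.of_forall fun y => ?_)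
    simp
  have k1 : ∫ y, φ y ∂η ≤ ∫ y, φ y ∂ν := hη.2 φ hφ (integrable_add_measure.mpr ⟨hφη, hφν⟩)
  have k2 : ∫ y, φ y ∂ν ≤ ∫ y, g y ∂ν := integral_mono hφν hg hφg
  have hfπ : Integrable (fun p : E × E => f p.1) π := by
    rw [← h1] at hf
    exact hf.comp_measurable measurable_fst
  have hφπ : Integrable (fun p : E × E => φ p.2) π := by
    rw [← h2] at hφη
    exact hφη.comp_measurable measurable_snd
  have k3 : ∫ p, (-f p.1 - t * ‖p.1 - p.2‖ ^ ρ) ∂π ≤ ∫ p, φ p.2 ∂π := by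
    refine integral_mono (hfπ.neg.sub (hc.const_mul t)) hφπ fun p => ?_
    have := hAφ p p.2
    simpa [A] using this
  have hfn : Integrable (fun p : E × E => -f p.1) π := hfπ.neg
  rw [integral_sub hfn (hc.const_mul t), integral_neg, integral_const_mul] at k3
  have e1 : ∫ p, f p.1 ∂π = ∫ x, f x ∂μ := by
    rw [← h1] at hf ⊢
    exact (integral_map measurable_fst.aemeasurable hf.1).symm
  have e2 : ∫ p, φ p.2 ∂π = ∫ x, φ x ∂η := by
    rw [← h2] at hφη ⊢
    exact (integral_map measurable_snd.aemeasurable hφη.1).symm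
  rw [e1, e2] at k3
  linarith

/-- The finitely additive optimal functional. -/
lemma exists_functional {ρ : ℝ} (hρ : 1 ≤ ρ) {μ ν : Measure E} [IsProbabilityMeasure μ]
    [IsProbabilityMeasure ν] (hμ1 : Integrable (fun y : E => ‖y‖) μ)
    (hν1 : Integrable (fun y : E => ‖y‖) ν) (I : ℝ)
    (hI : ∀ ε > 0, ∃ (η : Measure E) (π : Measure (E × E)), IsProbabilityMeasure η ∧
      ConvexOrder η ν ∧ π.map Prod.fst = μ ∧ π.map Prod.snd = η ∧
      Integrable (fun p : E × E => ‖p.1 - p.2‖ ^ ρ) π ∧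
      I ≤ ∫ p, ‖p.1 - p.2‖ ^ ρ ∂π ∧ ∫ p, ‖p.1 - p.2‖ ^ ρ ∂π ≤ I + ε) :
    ∃ L : (E × E × E → ℝ) →ₗ[ℝ] ℝ,
      (∀ F : E × E × E → ℝ, (∀ p, 0 ≤ F p) →
        (∃ C, ∀ p, F p ≤ C * (1 + ‖p.1‖ + ‖p.2.2‖ + ‖p.1 - p.2.1‖ ^ ρ)) → 0 ≤ L F) ∧
      (∀ f : E → ℝ, Integrable f μ → L (fun p => f p.1) = ∫ x, f x ∂μ) ∧
      (∀ g : E → ℝ, Integrable g ν → L (fun p => g p.2.2) = ∫ x, g x ∂ν) ∧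
      (∀ h : E × E → E, (∃ C, ∀ p, ‖h p‖ ≤ C) →
        L (fun p => inner ℝ (h (p.1, p.2.1)) (p.2.2 - p.2.1)) = 0) ∧
      L (fun p => ‖p.1 - p.2.1‖ ^ ρ) = I := by
  let Q : Submodule ℝ ((E → ℝ) × (E → ℝ) × (E × E → E) × ℝ) :=
    { carrier := {q | Integrable q.1 μ ∧ Integrable q.2.1 ν ∧ ∃ C, ∀ p, ‖q.2.2.1 p‖ ≤ C}
      add_mem' := by
        rintro q r ⟨h1, h2, C, h3⟩ ⟨k1, k2, D, k3⟩
        exact ⟨h1.add k1, h2.add k2, C + D, fun p =>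
          (norm_add_le _ _).trans (add_le_add (h3 p) (k3 p))⟩
      zero_mem' := ⟨integrable_zero _ _ _, integrable_zero _ _ _, 0, fun p => by simp⟩
      smul_mem' := by
        rintro c q ⟨h1, h2, C, h3⟩
        refine ⟨h1.smul c, h2.smul c, ‖c‖ * C, fun p => ?_⟩
        change ‖c • q.2.2.1 p‖ ≤ _
        rw [norm_smul]
        exact mul_le_mul_of_nonneg_left (h3 p) (norm_nonneg c) }
  let T : Q →ₗ[ℝ] (E × E × E → ℝ) :=
    { toFun := fun q p => q.1.1 p.1 + q.1.2.1 p.2.2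
        + inner ℝ (q.1.2.2.1 (p.1, p.2.1)) (p.2.2 - p.2.1) + q.1.2.2.2 * ‖p.1 - p.2.1‖ ^ ρ
      map_add' := fun q r => by
        ext p
        simp [inner_add_left]
        ring
      map_smul' := fun c q => by
        ext p
        simp [inner_smul_left]
        ring }
  let l : Q →ₗ[ℝ] ℝ :=
    { toFun := fun q => ∫ x, q.1.1 x ∂μ + ∫ y, q.1.2.1 y ∂ν + q.1.2.2.2 * I
      map_add' := fun q r => by
        have e1 : ∫ x, (q + r).1.1 x ∂μ = ∫ x, q.1.1 x ∂μ + ∫ x, r.1.1 x ∂μ :=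
          integral_add q.2.1 r.2.1
        have e2 : ∫ x, (q + r).1.2.1 x ∂ν = ∫ x, q.1.2.1 x ∂ν + ∫ x, r.1.2.1 x ∂ν :=
          integral_add q.2.2.1 r.2.2.1
        rw [e1, e2]
        simp
        ring
      map_smul' := fun c q => by
        have e1 : ∫ x, (c • q).1.1 x ∂μ = c * ∫ x, q.1.1 x ∂μ := integral_const_mul c _
        have e2 : ∫ x, (c • q).1.2.1 x ∂ν = c * ∫ x, q.1.2.1 x ∂ν := integral_const_mul c _
        rw [e1, e2]
        simp
        ring }
  have hT : ∀ q p, T q p = q.1.1 p.1 + q.1.2.1 p.2.2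
        + inner ℝ (q.1.2.2.1 (p.1, p.2.1)) (p.2.2 - p.2.1) + q.1.2.2.2 * ‖p.1 - p.2.1‖ ^ ρ :=
    fun q p => rfl
  have hl : ∀ q, l q = ∫ x, q.1.1 x ∂μ + ∫ y, q.1.2.1 y ∂ν + q.1.2.2.2 * I := fun q => rfl
  have hpos : ∀ q, (∀ p, 0 ≤ T q p) → 0 ≤ l q := by
    intro q hq
    rw [hl]
    have key : ∀ ε > 0, 0 ≤ ∫ x, q.1.1 x ∂μ + ∫ y, q.1.2.1 y ∂ν + q.1.2.2.2 * I
        + |q.1.2.2.2| * ε := by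
      intro ε hε
      obtain ⟨η, π, _, hη, h1, h2, hc, hI1, hI2⟩ := hI ε hε
      have := weak_pos (f := q.1.1) (g := q.1.2.1) (h := q.1.2.2.1) (t := q.1.2.2.2) hν1
        q.2.1 q.2.2.1 (fun x z y => hq (x, z, y)) hη h1 h2 hc
      rcases le_total 0 q.1.2.2.2 with ht | ht
      · rw [abs_of_nonneg ht]
        nlinarith
      · nlinarith [abs_nonneg q.1.2.2.2]
    by_contra! hneg
    set S := ∫ x, q.1.1 x ∂μ + ∫ y, q.1.2.1 y ∂ν + q.1.2.2.2 * I
    have h1 : 0 < |q.1.2.2.2| + 1 := by positivity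
    have h2 := key (-S / (2 * (|q.1.2.2.2| + 1))) (by apply div_pos <;> linarith)
    have h3 : |q.1.2.2.2| * (-S / (2 * (|q.1.2.2.2| + 1))) ≤ -S / 2 := by
      rw [mul_div_assoc', div_le_div_iff₀ (by positivity) (by positivity)]
      nlinarith [abs_nonneg q.1.2.2.2]
    linarith
  let B : ∀ C : ℝ, Q := fun C => ⟨(fun x => C * (1 + ‖x‖), fun y => C * ‖y‖, 0, C),
    ((integrable_const (1 : ℝ)).add hμ1).const_mul C, hν1.const_mul C, 0, fun p => by simp⟩
  have hB : ∀ C p, T (B C) p = C * (1 + ‖p.1‖ + ‖p.2.2‖ + ‖p.1 - p.2.1‖ ^ ρ) := by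
    intro C p
    rw [hT]
    simp [B]
    ring
  have hdom : ∀ q, ∃ q', ∀ p, |T q p| ≤ T q' p := by
    intro q
    obtain ⟨C, hC⟩ := q.2.2.2
    have hC0 : 0 ≤ C := (norm_nonneg _).trans (hC 0)
    let q1 : Q := ⟨(fun x => |q.1.1 x|, fun y => |q.1.2.1 y|, 0, |q.1.2.2.2|),
      q.2.1.norm, q.2.2.1.norm, 0, fun p => by simp⟩
    refine ⟨q1 + B C, fun p => ?_⟩
    rw [map_add, Pi.add_apply, hB, hT, hT]
    simp only [q1, Pi.zero_apply, inner_zero_left, add_zero]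
    have i1 : |inner ℝ (q.1.2.2.1 (p.1, p.2.1)) (p.2.2 - p.2.1)|
        ≤ C * (1 + ‖p.1‖ + ‖p.2.2‖ + ‖p.1 - p.2.1‖ ^ ρ) := by
      refine (abs_real_inner_le_norm _ _).trans
        (mul_le_mul (hC _) ?_ (norm_nonneg _) hC0)
      have j1 := norm_le_one_add_rpow hρ (norm_nonneg (p.1 - p.2.1))
      have j2 : ‖p.2.2 - p.2.1‖ ≤ ‖p.2.2‖ + ‖p.1‖ + ‖p.1 - p.2.1‖ := by
        have : p.2.2 - p.2.1 = p.2.2 - p.1 + (p.1 - p.2.1) := by abel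
        rw [this]
        exact (norm_add_le _ _).trans (add_le_add (norm_sub_le _ _) le_rfl)
      linarith
    have i2 : |q.1.2.2.2 * ‖p.1 - p.2.1‖ ^ ρ| = |q.1.2.2.2| * ‖p.1 - p.2.1‖ ^ ρ := by
      rw [abs_mul, abs_of_nonneg (Real.rpow_nonneg (norm_nonneg (p.1 - p.2.1)) ρ)]
    have i3 := abs_add_le (q.1.1 p.1 + q.1.2.1 p.2.2
      + inner ℝ (q.1.2.2.1 (p.1, p.2.1)) (p.2.2 - p.2.1)) (q.1.2.2.2 * ‖p.1 - p.2.1‖ ^ ρ)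
    have i4 := abs_add_le (q.1.1 p.1 + q.1.2.1 p.2.2)
      (inner ℝ (q.1.2.2.1 (p.1, p.2.1)) (p.2.2 - p.2.1))
    have i5 := abs_add_le (q.1.1 p.1) (q.1.2.1 p.2.2)
    linarith
  obtain ⟨L, hL1, hL2⟩ := pos_ext T l hpos hdom
  refine ⟨L, ?_, ?_, ?_, ?_, ?_⟩
  · rintro F hF ⟨C, hC⟩
    exact hL2 F hF ⟨B C, fun p => by rw [hB]; exact hC p⟩
  · intro f hf
    let q : Q := ⟨(f, 0, 0, 0), hf, integrable_zero _ _ _, 0, fun p => by simp⟩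
    have := hL1 q
    rw [hl] at this
    have e : T q = fun p => f p.1 := by
      ext p
      rw [hT]
      simp [q]
    rw [e] at this
    simpa [q] using this
  · intro f hf
    let q : Q := ⟨(0, f, 0, 0), integrable_zero _ _ _, hf, 0, fun p => by simp⟩
    have := hL1 q
    rw [hl] at this
    have e : T q = fun p => f p.2.2 := by
      ext p
      rw [hT]
      simp [q]
    rw [e] at this
    simpa [q] using this
  · intro h hh
    let q : Q := ⟨(0, 0, h, 0), integrable_zero _ _ _, integrable_zero _ _ _, hh⟩
    have := hL1 q
    rw [hl] at this
    have e : T q = fun p => inner ℝ (h (p.1, p.2.1)) (p.2.2 - p.2.1) := by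
      ext p
      rw [hT]
      simp [q]
    rw [e] at this
    simpa [q] using this
  · let q : Q := ⟨(0, 0, 0, 1), integrable_zero _ _ _, integrable_zero _ _ _, 0,
      fun p => by simp⟩
    have := hL1 q
    rw [hl] at this
    have e : T q = fun p => ‖p.1 - p.2.1‖ ^ ρ := by
      ext p
      rw [hT]
      simp [q]
    rw [e] at this
    simpa [q] using this

/-- Cutoff functions. -/
def cutoff {X : Type*} [NormedAddCommGroup X] (n : ℕ) (p : X) : ℝ :=
  max 0 (min 1 ((n : ℝ) + 1 - ‖p‖))

lemma cutoff_nonneg {X : Type*} [NormedAddCommGroup X] (n : ℕ) (p : X) : 0 ≤ cutoff n p :=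
  le_max_left _ _

lemma cutoff_le_one {X : Type*} [NormedAddCommGroup X] (n : ℕ) (p : X) : cutoff n p ≤ 1 :=
  max_le zero_le_one (min_le_left _ _)

lemma cutoff_eq_one {X : Type*} [NormedAddCommGroup X] {n : ℕ} {p : X} (h : ‖p‖ ≤ n) :
    cutoff n p = 1 := by
  unfold cutoff
  rw [min_eq_left (by linarith), max_eq_right zero_le_one]

lemma cutoff_continuous {X : Type*} [NormedAddCommGroup X] (n : ℕ) :
    Continuous (cutoff n : X → ℝ) := by
  unfold cutoff
  fun_prop

lemma cutoff_compact {X : Type*} [NormedAddCommGroup X] [ProperSpace X] (n : ℕ) :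
    HasCompactSupport (cutoff n : X → ℝ) := by
  refine HasCompactSupport.intro (isCompact_closedBall (0 : X) ((n : ℝ) + 1)) fun p hp => ?_
  rw [Metric.mem_closedBall, dist_zero_right, not_le] at hp
  unfold cutoff
  rw [max_eq_left]
  exact (min_le_right _ _).trans (by linarith)

lemma cutoff_tendsto {X : Type*} [NormedAddCommGroup X] (p : X) :
    Filter.Tendsto (fun n : ℕ => cutoff n p) Filter.atTop (nhds 1) := by
  obtain ⟨N, hN⟩ := exists_nat_ge ‖p‖
  refine tendsto_const_nhds.congr' ?_
  filter_upwards [Filter.eventually_ge_atTop N] with n hn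
  have : (N : ℝ) ≤ n := by exact_mod_cast hn
  exact (cutoff_eq_one (hN.trans this)).symm

/-- Representation of a positive functional by a measure. -/
lemma exists_repr {X : Type*} [NormedAddCommGroup X] [NormedSpace ℝ X] [FiniteDimensional ℝ X]
    [MeasurableSpace X] [BorelSpace X] (L : (X → ℝ) →ₗ[ℝ] ℝ) (W : X → ℝ) (hW : ∀ p, 1 ≤ W p)
    (hL : ∀ F : X → ℝ, (∀ p, 0 ≤ F p) → (∃ C, ∀ p, F p ≤ C * W p) → 0 ≤ L F) :
    ∃ θ : Measure X,
      (∀ F : X → ℝ, Continuous F → (∀ p, 0 ≤ F p) → (∃ C, ∀ p, F p ≤ C * W p) →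
        ∫⁻ p, ENNReal.ofReal (F p) ∂θ ≤ ENNReal.ofReal (L F)) ∧
      (∀ U : X → ℝ, Continuous U → (∀ p, 0 ≤ U p) → (∃ C, ∀ p, U p ≤ C * W p) →
        Filter.Tendsto (fun n : ℕ => L (fun p => U p * (1 - cutoff n p))) Filter.atTop (nhds 0) →
        ∀ F : X → ℝ, Continuous F → (∀ p, |F p| ≤ U p) →
          Integrable F θ ∧ ∫ p, F p ∂θ = L F) := by
  have : ProperSpace X := FiniteDimensional.proper ℝ X
  have hmono : ∀ F G : X → ℝ, (∀ p, F p ≤ G p) → (∃ C, ∀ p, G p - F p ≤ C * W p) →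
      L F ≤ L G := by
    intro F G h1 h2
    have := hL (G - F) (fun p => sub_nonneg.mpr (h1 p)) h2
    rw [map_sub] at this
    linarith
  let L0 : CompactlySupportedContinuousMap X ℝ →ₗ[ℝ] ℝ :=
    { toFun := fun f => L f
      map_add' := fun f g => by rw [← map_add]; rfl
      map_smul' := fun c f => by rw [RingHom.id_apply, ← map_smul]; rfl }
  let Λ : CompactlySupportedContinuousMap X ℝ →ₚ[ℝ] ℝ := PositiveLinearMap.mk₀ L0 (by
    intro f hf
    refine hL f (fun p => hf p) ?_
    obtain ⟨C, hC⟩ := f.hasCompactSupport.exists_bound_of_continuous f.continuous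
    refine ⟨C, fun p => ?_⟩
    have h1 := hC p
    have h2 : 0 ≤ C := (norm_nonneg _).trans h1
    have h3 := le_abs_self (f p)
    rw [Real.norm_eq_abs] at h1
    nlinarith [hW p])
  let θ : Measure X := RealRMK.rieszMeasure Λ
  have hcut : ∀ F : X → ℝ, Continuous F → ∀ n : ℕ, Integrable (fun p => F p * cutoff n p) θ ∧
      ∫ p, F p * cutoff n p ∂θ = L (fun p => F p * cutoff n p) := by
    intro F hF n
    let f : CompactlySupportedContinuousMap X ℝ := ⟨⟨fun p => F p * cutoff n p, hF.mul (cutoff_continuous n)⟩,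
      (cutoff_compact n).mul_left⟩
    refine ⟨?_, RealRMK.integral_rieszMeasure Λ f⟩
    exact (hF.mul (cutoff_continuous n)).integrable_of_hasCompactSupport
      (cutoff_compact n).mul_left
  have hA : ∀ F : X → ℝ, Continuous F → (∀ p, 0 ≤ F p) → (∃ C, ∀ p, F p ≤ C * W p) →
        ∫⁻ p, ENNReal.ofReal (F p) ∂θ ≤ ENNReal.ofReal (L F) := by
    rintro F hF h0 ⟨C, hC⟩
    have hlim : ∀ p, ENNReal.ofReal (F p)
        = Filter.liminf (fun n : ℕ => ENNReal.ofReal (F p * cutoff n p)) Filter.atTop := by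
      intro p
      refine (Filter.Tendsto.liminf_eq ?_).symm
      refine ENNReal.tendsto_ofReal ?_
      simpa using (cutoff_tendsto p).const_mul (F p)
    simp_rw [hlim]
    refine (lintegral_liminf_le fun n => by
      have := cutoff_continuous (X := X) n
      fun_prop).trans ?_
    refine Filter.liminf_le_of_frequently_le' (Filter.Frequently.of_forall fun n => ?_)
    rw [← ofReal_integral_eq_lintegral_ofReal (hcut F hF n).1
      (.of_forall fun p => mul_nonneg (h0 p) (cutoff_nonneg n p)), (hcut F hF n).2]
    refine ENNReal.ofReal_le_ofReal (hmono _ _ (fun p => ?_) ⟨C, fun p => ?_⟩)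
    · exact mul_le_of_le_one_right (h0 p) (cutoff_le_one n p)
    · have := mul_nonneg (h0 p) (cutoff_nonneg n p)
      linarith [hC p]
  refine ⟨θ, hA, ?_⟩
  rintro U hU hU0 ⟨C, hC⟩ hlim F hF hFU
  have hUi : Integrable U θ := by
    refine (lintegral_ofReal_ne_top_iff_integrable hU.aestronglyMeasurable
      (.of_forall hU0)).mp (ne_top_of_le_ne_top ENNReal.ofReal_ne_top (hA U hU hU0 ⟨C, hC⟩))
  have hFi : Integrable F θ := hUi.mono' hF.aestronglyMeasurable (.of_forall hFU)
  refine ⟨hFi, ?_⟩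
  have t1 : Filter.Tendsto (fun n : ℕ => ∫ p, F p * cutoff n p ∂θ) Filter.atTop
      (nhds (∫ p, F p ∂θ)) := by
    refine tendsto_integral_of_dominated_convergence U
      (fun n => (hcut F hF n).1.1) hUi (fun n => .of_forall fun p => ?_)
      (.of_forall fun p => ?_)
    · rw [Real.norm_eq_abs, abs_mul, abs_of_nonneg (cutoff_nonneg n p)]
      exact (mul_le_of_le_one_right (abs_nonneg _) (cutoff_le_one n p)).trans (hFU p)
    · simpa using (cutoff_tendsto p).const_mul (F p)
  have t2 : Filter.Tendsto (fun n : ℕ => L (fun p => F p * cutoff n p)) Filter.atTop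
      (nhds (L F)) := by
    rw [tendsto_iff_norm_sub_tendsto_zero]
    refine squeeze_zero (fun n => norm_nonneg _) (fun n => ?_) hlim
    have hb : ∀ p, |F p * (1 - cutoff n p)| ≤ U p * (1 - cutoff n p) := by
      intro p
      have h1 : 0 ≤ 1 - cutoff n p := sub_nonneg.mpr (cutoff_le_one n p)
      rw [abs_mul, abs_of_nonneg h1]
      exact mul_le_mul_of_nonneg_right (hFU p) h1
    have hUW : ∀ p, U p * (1 - cutoff n p) ≤ C * W p := fun p =>
      (mul_le_of_le_one_right (hU0 p) (by linarith [cutoff_nonneg n p])).trans (hC p)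
    have e : L (fun p => F p * cutoff n p) - L F = - L (fun p => F p * (1 - cutoff n p)) := by
      rw [← map_sub, ← map_neg]
      congr 1
      ext p
      simp
      ring
    rw [e, norm_neg, Real.norm_eq_abs, abs_le]
    constructor
    · rw [← map_neg]
      refine hmono _ _ (fun p => ?_) ⟨2 * C, fun p => ?_⟩
      · have := abs_le.mp (hb p)
        simpa using this.1
      · have := abs_le.mp (hb p)
        simp only [Pi.neg_apply]
        linarith [hUW p]
    · refine hmono _ _ (fun p => ?_) ⟨2 * C, fun p => ?_⟩
      · exact (abs_le.mp (hb p)).2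
      · have := abs_le.mp (hb p)
        linarith [hUW p]
  simp_rw [(hcut F hF _).2] at t1
  exact tendsto_nhds_unique t1 t2

/-- The positive part `(‖y‖ - K)⁺`. -/
def tail (K : ℝ) (y : E) : ℝ := max 0 (‖y‖ - K)

lemma tail_dummy (K : ℝ) (y : E) : 0 ≤ tail K y := le_max_left _ _

lemma tail_tendsto {ν : Measure E} (hν1 : Integrable (fun y : E => ‖y‖) ν) :
    Filter.Tendsto (fun K : ℕ => ∫ y, tail (K : ℝ) y ∂ν) Filter.atTop (nhds 0) := by
  have : ∫ y : E, (0 : ℝ) ∂ν = 0 := by simp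
  rw [← this]
  refine tendsto_integral_of_dominated_convergence (fun y => ‖y‖)
    (fun n => ?_) hν1 (fun n => .of_forall fun p => ?_) (.of_forall fun p => ?_)
  · unfold tail
    fun_prop
  · rw [Real.norm_eq_abs, abs_of_nonneg (tail_dummy _ _)]
    exact max_le (norm_nonneg _) (by linarith [(Nat.cast_nonneg n : (0 : ℝ) ≤ n)])
  · obtain ⟨N, hN⟩ := exists_nat_ge ‖p‖
    refine tendsto_const_nhds.congr' ?_
    filter_upwards [Filter.eventually_ge_atTop N] with n hn
    have : (N : ℝ) ≤ n := by exact_mod_cast hn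
    unfold tail
    rw [max_eq_left (by linarith)]

lemma tail_subgrad {K : ℝ} (hK : 0 ≤ K) : ∃ h : E → E, (∀ z, ‖h z‖ ≤ 1) ∧
    ∀ z y : E, tail K z + inner ℝ (h z) (y - z) ≤ tail K y := by
  classical
  refine ⟨fun z => if K < ‖z‖ then ‖z‖⁻¹ • z else 0, fun z => ?_, fun z y => ?_⟩
  · dsimp only
    split_ifs with h
    · have h0 : ‖z‖ ≠ 0 := (hK.trans_lt h).ne'
      rw [norm_smul, norm_inv, norm_norm, inv_mul_cancel₀ h0]
    · simp
  · dsimp only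
    split_ifs with h
    · have h0 : 0 < ‖z‖ := hK.trans_lt h
      have h1 : inner ℝ (‖z‖⁻¹ • z) (y - z) ≤ ‖y‖ - ‖z‖ := by
        rw [real_inner_smul_left, inner_sub_right, real_inner_self_eq_norm_sq]
        have := real_inner_le_norm z y
        rw [inv_mul_le_iff₀ h0]
        nlinarith
      unfold tail
      rw [max_eq_right (by linarith : 0 ≤ ‖z‖ - K)]
      exact le_trans (by linarith) (le_max_right _ _)
    · rw [inner_zero_left]
      unfold tail
      rw [max_eq_left (by linarith : ‖z‖ - K ≤ 0)]
      simp

lemma exists_triple {ρ : ℝ} (hρ : 1 ≤ ρ) {μ ν : Measure E} [IsProbabilityMeasure μ]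
    [IsProbabilityMeasure ν] (hν1 : Integrable (fun y : E => ‖y‖) ν) (I : ℝ)
    (L : (E × E × E → ℝ) →ₗ[ℝ] ℝ)
    (hL : ∀ F : E × E × E → ℝ, (∀ p, 0 ≤ F p) →
        (∃ C, ∀ p, F p ≤ C * (1 + ‖p.1‖ + ‖p.2.2‖ + ‖p.1 - p.2.1‖ ^ ρ)) → 0 ≤ L F)
    (hf : ∀ f : E → ℝ, Integrable f μ → L (fun p => f p.1) = ∫ x, f x ∂μ)
    (hg : ∀ g : E → ℝ, Integrable g ν → L (fun p => g p.2.2) = ∫ x, g x ∂ν)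
    (hh : ∀ h : E × E → E, (∃ C, ∀ p, ‖h p‖ ≤ C) →
        L (fun p => inner ℝ (h (p.1, p.2.1)) (p.2.2 - p.2.1)) = 0)
    (hI : L (fun p => ‖p.1 - p.2.1‖ ^ ρ) = I) :
    ∃ θ : Measure (E × E × E), IsProbabilityMeasure θ ∧ θ.map (fun p => p.1) = μ ∧
      θ.map (fun p => p.2.2) = ν ∧ Integrable (fun p => p.2.1) θ ∧
      Integrable (fun p => p.2.2) θ ∧
      ∫⁻ p, ENNReal.ofReal (‖p.1 - p.2.1‖ ^ ρ) ∂θ ≤ ENNReal.ofReal I ∧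
      ∀ k : E → ℝ, Continuous k → (∃ C, ∀ x, |k x| ≤ C) → ∀ v : E,
        ∫ p, inner ℝ (k p.1 • v) (p.2.2 - p.2.1) ∂θ = 0 := by
  let W : E × E × E → ℝ := fun p => 1 + ‖p.1‖ + ‖p.2.2‖ + ‖p.1 - p.2.1‖ ^ ρ
  have hW0 : ∀ p : E × E × E, 0 ≤ ‖p.1 - p.2.1‖ ^ ρ := fun p =>
    Real.rpow_nonneg (norm_nonneg _) _
  have hW : ∀ p, 1 ≤ W p := fun p => by
    have := hW0 p
    simp only [W]
    linarith [norm_nonneg p.1, norm_nonneg p.2.2]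
  have hzW : ∀ p : E × E × E, ‖p.2.1‖ ≤ W p := by
    intro p
    have j1 := norm_le_one_add_rpow hρ (norm_nonneg (p.1 - p.2.1))
    have j2 : ‖p.2.1‖ ≤ ‖p.1‖ + ‖p.1 - p.2.1‖ := by
      have : p.2.1 = p.1 - (p.1 - p.2.1) := by abel
      nth_rw 1 [this]
      exact norm_sub_le _ _
    simp only [W]
    linarith [norm_nonneg p.2.2]
  have hyW : ∀ p : E × E × E, ‖p.2.2‖ ≤ W p := by
    intro p
    have := hW0 p
    simp only [W]
    linarith [norm_nonneg p.1]
  have hxW : ∀ p : E × E × E, ‖p.1‖ ≤ W p := by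
    intro p
    have := hW0 p
    simp only [W]
    linarith [norm_nonneg p.2.2]
  obtain ⟨θ, hA, hB⟩ := exists_repr L W hW hL
  have hmono : ∀ F G : E × E × E → ℝ, (∀ p, F p ≤ G p) → (∃ C, ∀ p, G p - F p ≤ C * W p) →
      L F ≤ L G := by
    intro F G h1 h2
    have := hL (G - F) (fun p => sub_nonneg.mpr (h1 p)) h2
    rw [map_sub] at this
    linarith
  have htail : ∀ (K : ℝ) (y : E), 0 ≤ K → tail K y ≤ ‖y‖ := fun K y hK =>
    max_le (norm_nonneg _) (by linarith)
  have htint : ∀ K : ℝ, 0 ≤ K → Integrable (fun y : E => tail K y) ν := by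
    intro K hK
    refine hν1.mono' (by unfold tail; fun_prop) (.of_forall fun y => ?_)
    rw [Real.norm_eq_abs, abs_of_nonneg (tail_dummy _ _)]
    exact htail K y hK
  have hzt : ∀ K : ℝ, 0 ≤ K → L (fun p => tail K p.2.1) ≤ ∫ y, tail K y ∂ν := by
    intro K hK
    obtain ⟨h, h1, h2⟩ := tail_subgrad (E := E) hK
    rw [← hg _ (htint K hK)]
    have e := hh (fun p => h p.2) ⟨1, fun p => h1 _⟩
    have : L (fun p => tail K p.2.1) = L ((fun p => tail K p.2.1)
        + fun p => inner ℝ (h p.2.1) (p.2.2 - p.2.1)) := by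
      rw [map_add, e, add_zero]
    rw [this]
    refine hmono _ _ (fun p => h2 _ _) ⟨3, fun p => ?_⟩
    have i1 := htail K p.2.2 hK
    have i2 := tail_dummy K p.2.1
    have i3 : -(‖p.2.2‖ + ‖p.2.1‖) ≤ inner ℝ (h p.2.1) (p.2.2 - p.2.1) := by
      have := abs_le.mp ((abs_real_inner_le_norm (h p.2.1) (p.2.2 - p.2.1)).trans
        ((mul_le_of_le_one_left (norm_nonneg _) (h1 _)).trans (norm_sub_le _ _)))
      exact this.1
    simp only [Pi.add_apply]
    linarith [hzW p, hyW p]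
  let U : E × E × E → ℝ := fun p => 1 + ‖p.2.1‖ + ‖p.2.2‖
  have hU0 : ∀ p, 0 ≤ U p := fun p => by simp only [U]; positivity
  have hUW : ∀ p, U p ≤ 3 * W p := fun p => by
    simp only [U]
    linarith [hzW p, hyW p, hW p]
  have hlim : Filter.Tendsto (fun n : ℕ => L (fun p => U p * (1 - cutoff n p)))
      Filter.atTop (nhds 0) := by
    let S : E × E × E → ℝ := fun p => ‖p.1‖ + ‖p.2.1‖ + ‖p.2.2‖
    have hbound : ∀ K n : ℕ, 0 < n → L (fun p => U p * (1 - cutoff n p)) ≤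
        2 * ∫ y, tail (K : ℝ) y ∂ν + (1 + 2 * K) * L S / n := by
      intro K n hn
      have hn' : (0 : ℝ) < n := by exact_mod_cast hn
      have hK' : (0 : ℝ) ≤ K := Nat.cast_nonneg K
      have e1 : L ((fun p => tail (K : ℝ) p.2.1) + (fun p => tail (K : ℝ) p.2.2)
          + ((1 + 2 * K) / n : ℝ) • S) ≤
          2 * ∫ y, tail (K : ℝ) y ∂ν + (1 + 2 * K) * L S / n := by
        rw [map_add, map_add, map_smul, hg _ (htint K hK'), smul_eq_mul]
        have := hzt K hK'
        have e : ((1 + 2 * K) / n : ℝ) * L S = (1 + 2 * K) * L S / n := by ring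
        rw [e]
        linarith
      refine le_trans (hmono _ _ (fun p => ?_) ⟨2 + (1 + 2 * K) / n * 3, fun p => ?_⟩) e1
      · simp only [Pi.add_apply, Pi.smul_apply, smul_eq_mul]
        have c0 := cutoff_nonneg n p
        have c1 := cutoff_le_one n p
        have t1 := tail_dummy (K : ℝ) p.2.1
        have t2 := tail_dummy (K : ℝ) p.2.2
        have hS0 : 0 ≤ S p := by simp only [S]; positivity
        have hS1 : 0 ≤ (1 + 2 * K) / n * S p := by positivity
        rcases le_or_gt ‖p‖ n with h | h
        · rw [cutoff_eq_one h]
          linarith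
        · have u1 : ‖p.2.1‖ ≤ tail (K : ℝ) p.2.1 + K := by
            have : ‖p.2.1‖ - K ≤ tail (K : ℝ) p.2.1 := le_max_right _ _
            linarith
          have u2 : ‖p.2.2‖ ≤ tail (K : ℝ) p.2.2 + K := by
            have : ‖p.2.2‖ - K ≤ tail (K : ℝ) p.2.2 := le_max_right _ _
            linarith
          have u3 : ‖p‖ ≤ S p := by
            simp only [S]
            rw [Prod.norm_def, Prod.norm_def]
            have := norm_nonneg p.1
            have := norm_nonneg p.2.1
            have := norm_nonneg p.2.2
            refine max_le (by linarith) (max_le (by linarith) (by linarith))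
          have u4 : 1 ≤ S p / n := by
            rw [one_le_div hn']
            linarith
          have u5 : (1 + 2 * K : ℝ) ≤ (1 + 2 * K) / n * S p := by
            have : (1 + 2 * K : ℝ) / n * S p = (1 + 2 * K) * (S p / n) := by ring
            rw [this]
            exact le_mul_of_one_le_right (by positivity) u4
          have u6 : U p * (1 - cutoff n p) ≤ U p :=
            mul_le_of_le_one_right (hU0 p) (by linarith)
          simp only [U] at u6 ⊢
          linarith
      · simp only [Pi.add_apply, Pi.smul_apply, smul_eq_mul]
        have c1 : 0 ≤ U p * (1 - cutoff n p) :=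
          mul_nonneg (hU0 p) (by linarith [cutoff_le_one n p])
        have t1 := htail (K : ℝ) p.2.1 hK'
        have t2 := htail (K : ℝ) p.2.2 hK'
        have hS : S p ≤ 3 * W p := by
          simp only [S]
          linarith [hzW p, hyW p, hxW p]
        have hS1 : (1 + 2 * K) / n * S p ≤ (1 + 2 * K) / n * (3 * W p) :=
          mul_le_mul_of_nonneg_left hS (by positivity)
        linarith [hzW p, hyW p]
    have hnn : ∀ n : ℕ, 0 ≤ L (fun p => U p * (1 - cutoff n p)) := by
      intro n
      refine hL _ (fun p => mul_nonneg (hU0 p) (by linarith [cutoff_le_one n p]))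
        ⟨3, fun p => ?_⟩
      exact (mul_le_of_le_one_right (hU0 p) (by linarith [cutoff_nonneg n p])).trans (hUW p)
    rw [Metric.tendsto_atTop]
    intro ε hε
    obtain ⟨K, hK⟩ := ((Metric.tendsto_atTop.mp (tail_tendsto hν1)) (ε / 4) (by positivity))
    have hK := hK K le_rfl
    rw [Real.dist_eq, sub_zero] at hK
    have hK2 := (le_abs_self _).trans_lt hK
    have ht : Filter.Tendsto (fun n : ℕ => (1 + 2 * (K : ℝ)) * L S / n) Filter.atTop (nhds 0) :=
      tendsto_const_div_atTop_nhds_zero_nat _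
    obtain ⟨N, hN⟩ := (Metric.tendsto_atTop.mp ht) (ε / 2) (by positivity)
    refine ⟨N + 1, fun n hn => ?_⟩
    have hN2 := hN n (by omega)
    rw [Real.dist_eq, sub_zero] at hN2
    have hN3 := (le_abs_self _).trans_lt hN2
    rw [Real.dist_eq, sub_zero, abs_of_nonneg (hnn n)]
    have := hbound K n (by omega)
    linarith
  have hUc : Continuous U := by simp only [U]; fun_prop
  have hB' := hB U hUc hU0 ⟨3, hUW⟩ hlim
  have hBC : ∀ F : E × E × E → ℝ, Continuous F → (∃ C, ∀ p, |F p| ≤ C * U p) →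
      Integrable F θ ∧ ∫ p, F p ∂θ = L F := by
    rintro F hF ⟨C, hC⟩
    let D := |C| + 1
    have hD : 0 < D := by positivity
    have := hB' (D⁻¹ • F) (hF.const_smul _) (fun p => by
      simp only [Pi.smul_apply, smul_eq_mul]
      rw [abs_mul, abs_of_pos (inv_pos.mpr hD), inv_mul_le_iff₀ hD]
      refine (hC p).trans (mul_le_mul_of_nonneg_right ?_ (hU0 p))
      have := le_abs_self C
      simp only [D]
      linarith)
    rw [map_smul] at this
    have h1 := this.2
    simp only [Pi.smul_apply, smul_eq_mul] at h1
    rw [integral_const_mul] at h1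
    refine ⟨?_, mul_left_cancel₀ (inv_ne_zero hD.ne') h1⟩
    have := this.1.smul D
    rwa [smul_smul, mul_inv_cancel₀ hD.ne', one_smul] at this
  have hU1 : ∀ p, 1 ≤ U p := fun p => by
    simp only [U]
    linarith [norm_nonneg p.2.1, norm_nonneg p.2.2]
  have h1 : L (fun _ => 1) = 1 := by
    have := hf (fun _ => 1) (integrable_const _)
    simpa using this
  have hfin : IsFiniteMeasure θ := by
    have := hA (fun _ => 1) continuous_const (fun _ => zero_le_one) ⟨1, fun p => by
      simpa using hW p⟩
    rw [h1] at this
    constructor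
    simp only [ENNReal.ofReal_one, lintegral_const, one_mul] at this
    exact this.trans_lt ENNReal.one_lt_top
  have hmx : θ.map (fun p => p.1) = μ := by
    refine ext_of_forall_integral_eq_of_IsFiniteMeasure fun f => ?_
    rw [integral_map (by fun_prop) (by fun_prop), ← hf f (f.integrable μ)]
    refine (hBC _ (by fun_prop) ⟨‖f‖, fun p => ?_⟩).2
    exact (f.norm_coe_le_norm p.1).trans (le_mul_of_one_le_right (norm_nonneg f) (hU1 p))
  have hmy : θ.map (fun p => p.2.2) = ν := by
    refine ext_of_forall_integral_eq_of_IsFiniteMeasure fun f => ?_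
    rw [integral_map (by fun_prop) (by fun_prop), ← hg f (f.integrable ν)]
    refine (hBC _ (by fun_prop) ⟨‖f‖, fun p => ?_⟩).2
    exact (f.norm_coe_le_norm p.2.2).trans (le_mul_of_one_le_right (norm_nonneg f) (hU1 p))
  refine ⟨θ, ?_, hmx, hmy, ?_, ?_, ?_, ?_⟩
  · constructor
    have : μ univ = 1 := measure_univ
    rw [← hmx, Measure.map_apply (by fun_prop) MeasurableSet.univ] at this
    simpa using this
  · refine (integrable_norm_iff (by fun_prop)).mp (hBC _ (by fun_prop) ⟨1, fun p => ?_⟩).1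
    rw [abs_of_nonneg (norm_nonneg _)]
    simp only [U]
    linarith [norm_nonneg p.2.2]
  · refine (integrable_norm_iff (by fun_prop)).mp (hBC _ (by fun_prop) ⟨1, fun p => ?_⟩).1
    rw [abs_of_nonneg (norm_nonneg _)]
    simp only [U]
    linarith [norm_nonneg p.2.1]
  · rw [← hI]
    refine hA _ ?_ hW0 ⟨1, fun p => ?_⟩
    · exact Continuous.rpow_const (by fun_prop) (fun _ => Or.inr (by linarith))
    · simp only [W]
      linarith [norm_nonneg p.1, norm_nonneg p.2.2]
  · rintro k hk ⟨C, hC⟩ v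
    rw [(hBC _ (by fun_prop) ⟨C * ‖v‖, fun p => ?_⟩).2]
    · refine hh (fun p => k p.1 • v) ⟨C * ‖v‖, fun p => ?_⟩
      rw [norm_smul]
      exact mul_le_mul_of_nonneg_right (hC _) (norm_nonneg _)
    · refine (abs_real_inner_le_norm _ _).trans (mul_le_mul ?_ ?_ (norm_nonneg _) ?_)
      · rw [norm_smul]
        exact mul_le_mul_of_nonneg_right (hC _) (norm_nonneg _)
      · refine (norm_sub_le _ _).trans ?_
        simp only [U]
        linarith
      · exact mul_nonneg ((abs_nonneg _).trans (hC 0)) (norm_nonneg _)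

lemma integrable_inner_integral {α β G : Type*} [MeasurableSpace α] [MeasurableSpace β]
    [NormedAddCommGroup G] [NormedSpace ℝ G] {μ : Measure α} [SFinite μ] {κ : Kernel α β}
    [IsSFiniteKernel κ] {f : α × β → G} (hf : Integrable f (μ ⊗ₘ κ)) :
    Integrable (fun x => ∫ y, f (x, y) ∂(κ x)) μ := by
  rw [Measure.compProd] at hf
  have := hf.integral_compProd
  simpa using this

lemma exists_kernel {ρ : ℝ} (hρ : 1 ≤ ρ) {μ ν : Measure E} [IsProbabilityMeasure μ]
    [IsProbabilityMeasure ν] (I : ℝ≥0∞) (θ : Measure (E × E × E)) [IsProbabilityMeasure θ]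
    (hx : θ.map (fun p => p.1) = μ) (hy : θ.map (fun p => p.2.2) = ν)
    (hzi : Integrable (fun p => p.2.1) θ) (hyi : Integrable (fun p => p.2.2) θ)
    (hI : ∫⁻ p, ENNReal.ofReal (‖p.1 - p.2.1‖ ^ ρ) ∂θ ≤ I)
    (hk : ∀ k : E → ℝ, Continuous k → (∃ C, ∀ x, |k x| ≤ C) → ∀ v : E,
        ∫ p, inner ℝ (k p.1 • v) (p.2.2 - p.2.1) ∂θ = 0) :
    ∃ R : Kernel E E, IsMarkovKernel R ∧ μ.bind ⇑R = ν ∧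
      ∫⁻ x, ENNReal.ofReal (‖x - ∫ y, y ∂(R x)‖ ^ ρ) ∂μ ≤ I := by
  let κ : Kernel E (E × E) := θ.condKernel
  have hdis : μ ⊗ₘ κ = θ := by
    have : θ.fst = μ := hx
    rw [← this]
    exact θ.disintegrate κ
  have hm : ∀ x, ∫ y, y ∂(κ.snd x) = ∫ q, q.2 ∂(κ x) := by
    intro x
    rw [Kernel.snd_apply, integral_map (by fun_prop) (by fun_prop)]
  rw [← hdis] at hzi hyi
  have hz2 := (Measure.integrable_compProd_iff hzi.1).mp hzi
  have hy2 := (Measure.integrable_compProd_iff hyi.1).mp hyi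
  have hmz : Integrable (fun x => ∫ q, q.1 ∂(κ x)) μ := integrable_inner_integral hzi
  have hmy : Integrable (fun x => ∫ q, q.2 ∂(κ x)) μ := integrable_inner_integral hyi
  have hae : ∀ᵐ x ∂μ, (∫ q, q.2 ∂(κ x)) - (∫ q, q.1 ∂(κ x)) = 0 := by
    refine ae_eq_zero_of_integral_contDiff_smul_eq_zero (hmy.sub hmz).locallyIntegrable ?_
    intro k hk1 hk2
    obtain ⟨C, hC⟩ := hk2.exists_bound_of_continuous hk1.continuous
    have hkc := hk1.continuous
    have hint : Integrable (fun p : E × E × E => k p.1 • (p.2.2 - p.2.1)) (μ ⊗ₘ κ) := by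
      refine (hyi.sub hzi).bdd_smul C (φ := fun p => k p.1) ?_ (.of_forall fun p => hC p.1)
      exact (hkc.comp continuous_fst).aestronglyMeasurable
    have e1 : ∫ x, k x • ((∫ q, q.2 ∂(κ x)) - (∫ q, q.1 ∂(κ x))) ∂μ
        = ∫ p, k p.1 • (p.2.2 - p.2.1) ∂(μ ⊗ₘ κ) := by
      rw [Measure.integral_compProd hint]
      refine integral_congr_ae ?_
      filter_upwards [hz2.1, hy2.1] with x h1 h2
      rw [integral_smul, integral_sub h2 h1]
    refine Eq.trans e1 ?_
    refine ext_inner_left ℝ fun v => ?_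
    rw [← integral_inner hint, inner_zero_right, hdis, ← hk k hkc ⟨C, hC⟩ v]
    refine integral_congr_ae (.of_forall fun p => ?_)
    simp only [inner_smul_right, real_inner_smul_left]
  refine ⟨κ.snd, inferInstance, ?_, ?_⟩
  · rw [← hy, ← hdis]
    ext s hs
    rw [Measure.bind_apply hs (Kernel.aemeasurable _), Measure.map_apply (by fun_prop) hs,
      Measure.compProd_apply (measurableSet_preimage (by fun_prop) hs)]
    refine lintegral_congr fun x => ?_
    rw [Kernel.snd_apply' _ _ hs]
    rfl
  · refine le_trans ?_ hI
    rw [← hdis, Measure.lintegral_compProd (by fun_prop)]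
    refine lintegral_mono_ae ?_
    filter_upwards [hae, hz2.1] with x h1 h2
    rw [hm, sub_eq_zero.mp h1]
    exact jensen_lintegral (κ x) h2 (convexOn_norm_rpow hρ x)
      (fun w => Real.rpow_nonneg (norm_nonneg _) _)

lemma kernel_to_measure {ρ : ℝ} {μ ν : Measure E} [IsProbabilityMeasure μ]
    [IsProbabilityMeasure ν] (hν1 : Integrable (fun y : E => ‖y‖) ν) (hρ : 1 ≤ ρ)
    (R : Kernel E E) [IsMarkovKernel R] (hR : μ.bind ⇑R = ν) :
    ∃ η : Measure E, IsProbabilityMeasure η ∧ ConvexOrder η ν ∧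
      Wp ρ μ η ≤ ∫⁻ x, ENNReal.ofReal (‖x - ∫ y, y ∂(R x)‖ ^ ρ) ∂μ := by
  have hid : Integrable (fun y : E => y) ν := (integrable_norm_iff (by fun_prop)).mp hν1
  have hsnd : (μ ⊗ₘ R).map Prod.snd = ν := by
    rw [← hR]
    exact Measure.snd_compProd μ R
  have hpi : ∀ φ : E → ℝ, Integrable φ ν → Integrable (fun p : E × E => φ p.2) (μ ⊗ₘ R) := by
    intro φ hφ
    rw [← hsnd] at hφ
    exact hφ.comp_measurable measurable_snd
  have hidp : Integrable (fun p : E × E => p.2) (μ ⊗ₘ R) := by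
    rw [← hsnd] at hid
    exact hid.comp_measurable measurable_snd
  have hae := ((Measure.integrable_compProd_iff hidp.1).mp hidp).1
  let m : E → E := fun x => ∫ y, y ∂(R x)
  have hmm : Measurable m :=
    (StronglyMeasurable.integral_kernel (κ := R) (f := fun y : E => y)
      measurable_id.stronglyMeasurable).measurable
  refine ⟨μ.map m, Measure.isProbabilityMeasure_map hmm.aemeasurable, ⟨?_, ?_⟩, ?_⟩
  · intro φ hφ h0
    have hc := (convexOn_continuous hφ).measurable
    rw [lintegral_map (by fun_prop) hmm, ← hR,
      Measure.lintegral_bind (Kernel.aemeasurable _) (by fun_prop)]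
    refine lintegral_mono_ae ?_
    filter_upwards [hae] with x hx
    exact jensen_lintegral (R x) hx hφ h0
  · intro φ hφ hi
    have hc := convexOn_continuous hφ
    obtain ⟨i1, i2⟩ := integrable_add_measure.mp hi
    have i3 := hpi φ i2
    have i4 := ((Measure.integrable_compProd_iff i3.1).mp i3).1
    have e : ∫ y, φ y ∂ν = ∫ x, ∫ y, φ y ∂(R x) ∂μ := by
      rw [← Measure.integral_compProd i3, ← hsnd,
        integral_map (by fun_prop) hc.aestronglyMeasurable]
    rw [e, integral_map hmm.aemeasurable hc.aestronglyMeasurable]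
    refine integral_mono_ae (i1.comp_measurable hmm) (integrable_inner_integral i3) ?_
    filter_upwards [hae, i4] with x h1 h2
    exact hφ.map_integral_le hc.continuousOn isClosed_univ (.of_forall fun _ => mem_univ _) h1 h2
  · unfold Wp
    refine (iInf₂_le (μ.map fun x => (x, m x)) ?_).trans ((iInf_le _ ?_).trans ?_)
    · rw [Measure.map_map measurable_fst (by fun_prop)]
      exact Measure.map_id
    · rw [Measure.map_map measurable_snd (by fun_prop)]
      rfl
    · rw [lintegral_map (by fun_prop) (by fun_prop)]

lemma exists_opt {ρ : ℝ} (hρ : 1 ≤ ρ) {μ ν : Measure E} [IsProbabilityMeasure μ]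
    [IsProbabilityMeasure ν] (hμ1 : Integrable (fun y : E => ‖y‖) μ)
    (hν1 : Integrable (fun y : E => ‖y‖) ν) :
    ∃ R : Kernel E E, IsMarkovKernel R ∧ μ.bind ⇑R = ν ∧
      ∫⁻ x, ENNReal.ofReal (‖x - ∫ y, y ∂(R x)‖ ^ ρ) ∂μ ≤
        ⨅ (η : Measure E) (_ : IsProbabilityMeasure η) (_ : ConvexOrder η ν), Wp ρ μ η := by
  set I := ⨅ (η : Measure E) (_ : IsProbabilityMeasure η) (_ : ConvexOrder η ν), Wp ρ μ η
    with hIdef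
  by_cases htop : I = ∞
  · refine ⟨Kernel.const E ν, inferInstance, ?_, by rw [htop]; exact le_top⟩
    ext s hs
    rw [Measure.bind_apply hs (Kernel.aemeasurable _)]
    simp
  obtain ⟨L, h1, h2, h3, h4, h5⟩ := exists_functional hρ hμ1 hν1 I.toReal (by
    intro ε hε
    have hlt : I < I + ENNReal.ofReal ε :=
      ENNReal.lt_add_right htop (ENNReal.ofReal_pos.mpr hε).ne'
    nth_rw 1 [hIdef] at hlt
    simp only [Wp, iInf_lt_iff] at hlt
    obtain ⟨η, hηp, hη, π, hπ1, hπ2, hlt⟩ := hlt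
    have hle : I ≤ ∫⁻ p, ENNReal.ofReal (‖p.1 - p.2‖ ^ ρ) ∂π :=
      (iInf₂_le η hηp).trans ((iInf_le _ hη).trans
        ((iInf₂_le π hπ1).trans (iInf_le _ hπ2)))
    have hne : ∫⁻ p, ENNReal.ofReal (‖p.1 - p.2‖ ^ ρ) ∂π ≠ ∞ := ne_top_of_lt hlt
    have hnn : ∀ p : E × E, 0 ≤ ‖p.1 - p.2‖ ^ ρ := fun p => Real.rpow_nonneg (norm_nonneg _) _
    have hms : AEStronglyMeasurable (fun p : E × E => ‖p.1 - p.2‖ ^ ρ) π :=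
      Measurable.aestronglyMeasurable (by fun_prop)
    have hint := (lintegral_ofReal_ne_top_iff_integrable hms (.of_forall hnn)).mp hne
    have e : ∫ p, ‖p.1 - p.2‖ ^ ρ ∂π = (∫⁻ p, ENNReal.ofReal (‖p.1 - p.2‖ ^ ρ) ∂π).toReal :=
      integral_eq_lintegral_of_nonneg_ae (.of_forall hnn) hms
    refine ⟨η, π, hηp, hη, hπ1, hπ2, hint, ?_, ?_⟩
    · rw [e]
      exact ENNReal.toReal_mono hne hle
    · rw [e]
      have := ENNReal.toReal_mono (by finiteness) hlt.le
      rwa [ENNReal.toReal_add htop ENNReal.ofReal_ne_top, ENNReal.toReal_ofReal hε.le] at this)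
  obtain ⟨θ, _, k1, k2, k3, k4, k5, k6⟩ := exists_triple hρ hν1 I.toReal L h1 h2 h3 h4 h5
  rw [ENNReal.ofReal_toReal htop] at k5
  exact exists_kernel hρ I θ k1 k2 k3 k4 k5 k6

end core

/-- for `ρ ≥ 1` and `μ, ν ∈ P_ρ(ℝ^d)`, the infimum of
`J_ρ(R) = ∫ ‖x - m_R(x)‖^ρ μ(dx)` over Markov kernels `R` with `μR = ν` equals the infimum
of `W_ρ(μ,η)^ρ` over probability measures `η ≤cx ν`, and both infima are attained. -/
theorem stmt0 {d : ℕ} (ρ : ℝ) (hρ : 1 ≤ ρ)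
    (μ ν : Measure (EuclideanSpace ℝ (Fin d)))
    [IsProbabilityMeasure μ] [IsProbabilityMeasure ν]
    (hμρ : Integrable (fun x => ‖x‖ ^ ρ) μ) (hνρ : Integrable (fun x => ‖x‖ ^ ρ) ν) :
    let E := EuclideanSpace ℝ (Fin d)
    let J : Kernel E E → ℝ≥0∞ :=
      fun R => ∫⁻ x, ENNReal.ofReal (‖x - ∫ y, y ∂(R x)‖ ^ ρ) ∂μ
    ((⨅ (R : Kernel E E) (_ : IsMarkovKernel R) (_ : μ.bind ⇑R = ν), J R)
        = ⨅ (η : Measure E) (_ : IsProbabilityMeasure η) (_ : ConvexOrder η ν), Wp ρ μ η)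
    ∧ (∃ R : Kernel E E, IsMarkovKernel R ∧ μ.bind ⇑R = ν ∧
        J R = ⨅ (R' : Kernel E E) (_ : IsMarkovKernel R') (_ : μ.bind ⇑R' = ν), J R')
    ∧ (∃ η : Measure E, IsProbabilityMeasure η ∧ ConvexOrder η ν ∧
        Wp ρ μ η = ⨅ (η' : Measure E) (_ : IsProbabilityMeasure η')
          (_ : ConvexOrder η' ν), Wp ρ μ η') := by

  intro E J
  have hμ1 := integrable_norm_of_rpow hρ hμρ
  have hν1 := integrable_norm_of_rpow hρ hνρ
  obtain ⟨R, hRm, hRν, hRI⟩ := exists_opt hρ hμ1 hν1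
  have hle : (⨅ (η : Measure E) (_ : IsProbabilityMeasure η) (_ : ConvexOrder η ν), Wp ρ μ η)
      ≤ ⨅ (R : Kernel E E) (_ : IsMarkovKernel R) (_ : μ.bind ⇑R = ν), J R := by
    refine le_iInf fun R' => le_iInf fun hm => le_iInf fun hν => ?_
    obtain ⟨η, hη1, hη2, hη3⟩ := kernel_to_measure hν1 hρ R' hν
    exact (iInf₂_le η hη1).trans ((iInf_le _ hη2).trans hη3)
  have hle2 : (⨅ (R : Kernel E E) (_ : IsMarkovKernel R) (_ : μ.bind ⇑R = ν), J R) ≤ J R :=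
    (iInf₂_le R hRm).trans (iInf_le _ hRν)
  obtain ⟨η, hη1, hη2, hη3⟩ := kernel_to_measure hν1 hρ R hRν
  refine ⟨le_antisymm (hle2.trans hRI) hle, ⟨R, hRm, hRν, le_antisymm (hRI.trans hle) hle2⟩,
    ⟨η, hη1, hη2, le_antisymm (hη3.trans hRI) ?_⟩⟩
  exact (iInf₂_le η hη1).trans (iInf_le _ hη2)
end
end

section
/- Let ν ∈ P_1(ℝ^d). Then the set P̲(ν) = {η probability measure on ℝ^d : η ≤cx ν} is compact for the topology of weak convergence of probability measures. -/
open MeasureTheory ProbabilityTheory Set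
open scoped ENNReal

noncomputable section

/-- The sublevel sets of `η ↦ ∫ φ dη` are weakly closed when `φ` is continuous (nonnegative part). -/
lemma isClosed_lintegral_le {E : Type*} [TopologicalSpace E] [MeasurableSpace E]
    [OpensMeasurableSpace E] (φ : E → ℝ) (hφ : Continuous φ) (C : ℝ≥0∞) :
    IsClosed {η : ProbabilityMeasure E | ∫⁻ x, ENNReal.ofReal (φ x) ∂(η : Measure E) ≤ C} := by
  let f : ℕ → BoundedContinuousFunction E NNReal := fun n =>
    BoundedContinuousFunction.mkOfBound ⟨fun x => min (Real.toNNReal (φ x)) n, by fun_prop⟩ n (by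
      intro x y
      have h1 : min (Real.toNNReal (φ x)) n ≤ (n : NNReal) := min_le_right _ _
      have h2 : min (Real.toNNReal (φ y)) n ≤ (n : NNReal) := min_le_right _ _
      have h1' : ((min (Real.toNNReal (φ x)) n : NNReal) : ℝ) ≤ n := by exact_mod_cast h1
      have h2' : ((min (Real.toNNReal (φ y)) n : NNReal) : ℝ) ≤ n := by exact_mod_cast h2
      have h3 := (min (Real.toNNReal (φ x)) (n : NNReal)).coe_nonneg
      have h4 := (min (Real.toNNReal (φ y)) (n : NNReal)).coe_nonneg
      change dist (min (Real.toNNReal (φ x)) (n : NNReal)) (min (Real.toNNReal (φ y)) n) ≤ n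
      rw [NNReal.dist_eq, abs_le]
      constructor <;> linarith)
  have hf : ∀ n x, f n x = min (Real.toNNReal (φ x)) n := fun n x => rfl
  have key : ∀ η : ProbabilityMeasure E, ∫⁻ x, ENNReal.ofReal (φ x) ∂(η : Measure E)
      = ⨆ n, ∫⁻ x, (f n x : ℝ≥0∞) ∂(η : Measure E) := by
    intro η
    rw [← lintegral_iSup]
    · refine lintegral_congr fun x => ?_
      apply le_antisymm
      · obtain ⟨n, hn⟩ := exists_nat_ge (Real.toNNReal (φ x))
        refine le_iSup_of_le n ?_
        rw [hf, min_eq_left hn]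
        rfl
      · refine iSup_le fun n => ?_
        rw [hf]
        exact ENNReal.coe_le_coe.2 (min_le_left _ _)
    · intro n
      exact (f n).continuous.measurable.coe_nnreal_ennreal
    · intro m n hmn x
      simp only [hf]
      gcongr
  simp only [key, iSup_le_iff, setOf_forall]
  exact isClosed_iInter fun n =>
    isClosed_le (ProbabilityMeasure.continuous_lintegral_boundedContinuousFunction (f n))
      continuous_const

/-- The nonnegative part of the convex order implies the whole of it. -/
lemma convexOrder_of_nonneg {E : Type*} [NormedAddCommGroup E] [NormedSpace ℝ E]
    [MeasurableSpace E] (μ ν : Measure E) [IsProbabilityMeasure μ] [IsProbabilityMeasure ν]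
    (h : ∀ φ : E → ℝ, ConvexOn ℝ univ φ → (∀ x, 0 ≤ φ x) →
      ∫⁻ x, ENNReal.ofReal (φ x) ∂μ ≤ ∫⁻ x, ENNReal.ofReal (φ x) ∂ν) :
    ConvexOrder μ ν := by
  refine ⟨h, fun φ hφ hint => ?_⟩
  obtain ⟨hμ, hν⟩ := integrable_add_measure.1 hint
  have hI : ∀ (ρ : Measure E) [IsProbabilityMeasure ρ], Integrable φ ρ → ∀ n : ℕ,
      Integrable (fun x => max (φ x) (-(n : ℝ))) ρ := fun ρ _ hρ n =>
    hρ.sup (integrable_const _)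
  have hlim : ∀ (ρ : Measure E) [IsProbabilityMeasure ρ], Integrable φ ρ →
      Filter.Tendsto (fun n : ℕ => ∫ x, max (φ x) (-(n : ℝ)) ∂ρ) Filter.atTop
        (nhds (∫ x, φ x ∂ρ)) := by
    intro ρ _ hρ
    refine tendsto_integral_of_dominated_convergence (fun x => |φ x|)
      (fun n => (hI ρ hρ n).aestronglyMeasurable) hρ.abs ?_ ?_
    · intro n
      refine Filter.Eventually.of_forall fun x => ?_
      have hn : (0 : ℝ) ≤ n := Nat.cast_nonneg n
      rw [Real.norm_eq_abs, abs_le]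
      constructor
      · exact (neg_abs_le _).trans (le_max_left _ _)
      · exact max_le (le_abs_self _) (by linarith [abs_nonneg (φ x)])
    · refine Filter.Eventually.of_forall fun x => ?_
      obtain ⟨N, hN⟩ := exists_nat_ge (-φ x)
      refine tendsto_const_nhds.congr' ?_
      filter_upwards [Filter.eventually_ge_atTop N] with n hn
      have : (N : ℝ) ≤ n := by exact_mod_cast hn
      rw [max_eq_left]
      linarith
  refine le_of_tendsto_of_tendsto' (hlim μ hμ) (hlim ν hν) fun n => ?_
  have hpos : ∀ x, 0 ≤ max (φ x) (-(n : ℝ)) + n := fun x => by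
    linarith [le_max_right (φ x) (-(n : ℝ))]
  have hc : ConvexOn ℝ univ (fun x => max (φ x) (-(n : ℝ)) + n) :=
    (hφ.sup (convexOn_const _ convex_univ)).add_const _
  have h1 := h _ hc hpos
  have hIμ := (hI μ hμ n).add (integrable_const (n : ℝ))
  have hIν := (hI ν hν n).add (integrable_const (n : ℝ))
  have e1 := ofReal_integral_eq_lintegral_ofReal hIμ (Filter.Eventually.of_forall hpos)
  have e2 := ofReal_integral_eq_lintegral_ofReal hIν (Filter.Eventually.of_forall hpos)
  simp only [Pi.add_apply] at e1 e2
  rw [← e1, ← e2, ENNReal.ofReal_le_ofReal_iff (integral_nonneg hpos),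
    integral_add (hI μ hμ n) (integrable_const _),
    integral_add (hI ν hν n) (integrable_const _)] at h1
  simpa using h1

/-- for `ν ∈ P_1(ℝ^d)`, the set of probability measures dominated by `ν` in the
convex order is compact for the topology of weak convergence. -/
theorem stmt3 {d : ℕ}
    (ν : Measure (EuclideanSpace ℝ (Fin d)))
    [IsProbabilityMeasure ν] (hν : Integrable (fun x => ‖x‖) ν) :
    IsCompact {η : ProbabilityMeasure (EuclideanSpace ℝ (Fin d)) |
      ConvexOrder (η : Measure (EuclideanSpace ℝ (Fin d))) ν} := by
  set S := {η : ProbabilityMeasure (EuclideanSpace ℝ (Fin d)) |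
      ConvexOrder (η : Measure (EuclideanSpace ℝ (Fin d))) ν} with hS
  have hclosed : IsClosed S := by
    have : S = ⋂ (φ : EuclideanSpace ℝ (Fin d) → ℝ) (_ : ConvexOn ℝ univ φ) (_ : ∀ x, 0 ≤ φ x),
        {η : ProbabilityMeasure (EuclideanSpace ℝ (Fin d)) |
          ∫⁻ x, ENNReal.ofReal (φ x) ∂(η : Measure (EuclideanSpace ℝ (Fin d)))
            ≤ ∫⁻ x, ENNReal.ofReal (φ x) ∂ν} := by
      ext η
      simp only [mem_iInter]
      exact ⟨fun h => h.1, fun h => convexOrder_of_nonneg _ _ h⟩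
    rw [this]
    exact isClosed_iInter fun φ => isClosed_iInter fun hφ => isClosed_iInter fun _ =>
      isClosed_lintegral_le φ hφ.locallyLipschitz.continuous _
  have htight : IsTightMeasureSet {((μ : ProbabilityMeasure (EuclideanSpace ℝ (Fin d))) :
      Measure (EuclideanSpace ℝ (Fin d))) | μ ∈ S} := by
    apply isTightMeasureSet_of_tendsto_measure_norm_gt
    set C := ∫⁻ x, ENNReal.ofReal ‖x‖ ∂ν with hC
    have hCfin : C ≠ ∞ := hν.lintegral_lt_top.ne
    have hlim : Filter.Tendsto (fun r : ℝ => C / ENNReal.ofReal r) Filter.atTop (nhds 0) := by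
      have := ENNReal.Tendsto.const_div (a := C) ENNReal.tendsto_ofReal_atTop (Or.inr hCfin)
      simpa using this
    refine tendsto_of_tendsto_of_tendsto_of_le_of_le' tendsto_const_nhds hlim
      (Filter.Eventually.of_forall fun _ => zero_le) ?_
    filter_upwards [Filter.eventually_gt_atTop 0] with r hr
    refine iSup₂_le fun μ hμ => ?_
    obtain ⟨η, hη, rfl⟩ := hμ
    have h1 : ∫⁻ x, ENNReal.ofReal ‖x‖ ∂(η : Measure (EuclideanSpace ℝ (Fin d))) ≤ C :=
      hη.1 _ (convexOn_norm convex_univ) (fun x => norm_nonneg x)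
    rw [ENNReal.le_div_iff_mul_le (Or.inl (by simpa using hr)) (Or.inl ENNReal.ofReal_ne_top),
      mul_comm]
    refine le_trans ?_ h1
    refine le_trans ?_ (mul_meas_ge_le_lintegral₀ (by fun_prop) (ENNReal.ofReal r))
    gcongr
    intro hx
    exact ENNReal.ofReal_le_ofReal hx.le
  have := isCompact_closure_of_isTightMeasureSet htight
  rwa [hclosed.closure_eq] at this
end
end

section
/- Let ρ > 1, let μ, ν be probability measures on ℝ^d with μ ≤cx ν and ν ∈ P_ρ(ℝ^d), and for α ∈ ℝ^d let μ^α be the image of μ under x ↦ x + α. Then inf{W_ρ(μ^α, η) : η ≤cx ν} = |α|, and μ is the unique probability measure η with η ≤cx ν attaining this infimum; that is, the W_ρ-projection of μ^α on {η : η ≤cx ν} equals μ. -/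
open MeasureTheory ProbabilityTheory Set
open scoped ENNReal

noncomputable section

theorem aux_pos {E : Type*} [NormedAddCommGroup E] [InnerProductSpace ℝ E] (ρ : ℝ) (hρ : 1 < ρ)
    (α : E) : ∃ g : E, ∀ z, z ≠ α → 0 < ‖z‖ ^ ρ - ‖α‖ ^ ρ - inner ℝ g (z - α) := by
  have hρ0 : 0 < ρ := by linarith
  by_cases h0 : α = 0
  · refine ⟨0, fun z hz => ?_⟩
    subst h0
    have : 0 < ‖z‖ := norm_pos_iff.2 hz
    have := Real.rpow_pos_of_pos this ρ
    simpa [Real.zero_rpow hρ0.ne'] using this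
  have ha : 0 < ‖α‖ := norm_pos_iff.2 h0
  have hap : 0 < ‖α‖ ^ (ρ - 2) := Real.rpow_pos_of_pos ha _
  refine ⟨(ρ * ‖α‖ ^ (ρ - 2)) • α, fun z hz => ?_⟩
  rw [real_inner_smul_left, inner_sub_right, real_inner_self_eq_norm_sq]
  have hsq : ‖α‖ ^ ρ = ‖α‖ ^ (ρ - 2) * ‖α‖ ^ 2 := by
    rw [← Real.rpow_natCast, ← Real.rpow_add ha]; norm_num
  have hcs := real_inner_le_norm α z
  have hc : 0 < ρ * ‖α‖ ^ (ρ - 2) := mul_pos hρ0 hap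
  by_cases ht : ‖z‖ = ‖α‖
  · have hlt : inner ℝ α z < ‖α‖ * ‖z‖ := by
      refine lt_of_le_of_ne hcs fun h => ?_
      rw [inner_eq_norm_mul_iff_real, ht] at h
      exact hz (smul_right_injective E ha.ne' h).symm
    rw [ht] at hlt ⊢
    nlinarith
  · have hb := one_add_mul_self_lt_rpow_one_add (s := ‖z‖ / ‖α‖ - 1)
      (by have := div_nonneg (norm_nonneg z) ha.le; linarith)
      (by intro h; apply ht; field_simp at h; linarith) hρ
    rw [add_sub_cancel, Real.div_rpow (norm_nonneg _) ha.le,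
      lt_div_iff₀ (Real.rpow_pos_of_pos ha _)] at hb
    have h1 : (1 + ρ * (‖z‖ / ‖α‖ - 1)) * ‖α‖ ^ ρ
        = ‖α‖ ^ ρ + ρ * ‖α‖ ^ (ρ - 2) * (‖α‖ * ‖z‖ - ‖α‖ ^ 2) := by
      rw [hsq]; field_simp
    rw [h1] at hb
    have := mul_le_mul_of_nonneg_left hcs hc.le
    nlinarith

theorem aux_convex {E : Type*} [NormedAddCommGroup E] [NormedSpace ℝ E] (ρ : ℝ) (hρ : 1 < ρ) :
    ConvexOn ℝ univ (fun z : E => ‖z‖ ^ ρ) := by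
  have himg : (norm '' (univ : Set E)) ⊆ Ici (0 : ℝ) := by
    rintro _ ⟨x, -, rfl⟩; exact norm_nonneg x
  refine ⟨convex_univ, fun x _ y _ a b ha hb hab => ?_⟩
  have h1 : ‖a • x + b • y‖ ≤ a * ‖x‖ + b * ‖y‖ := by
    refine (norm_add_le _ _).trans ?_
    rw [norm_smul, norm_smul, Real.norm_of_nonneg ha, Real.norm_of_nonneg hb]
  have h2 := (convexOn_rpow hρ.le).2 (norm_nonneg x) (norm_nonneg y) ha hb hab
  exact (Real.rpow_le_rpow (norm_nonneg _) h1 (by linarith)).trans h2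

theorem aux_quant {E : Type*} [NormedAddCommGroup E] [InnerProductSpace ℝ E]
    [FiniteDimensional ℝ E] (ρ : ℝ) (hρ : 1 < ρ)
    (α : E) : ∃ g : E, (∀ z, 0 ≤ ‖z‖ ^ ρ - ‖α‖ ^ ρ - inner ℝ g (z - α)) ∧
      ∀ ε > 0, ∃ C : ℝ, 0 ≤ C ∧
        ∀ z, ‖z - α‖ ≤ ε + C * (‖z‖ ^ ρ - ‖α‖ ^ ρ - inner ℝ g (z - α)) := by
  obtain ⟨g, hg⟩ := aux_pos ρ hρ α
  have hg0 : ∀ z, 0 ≤ ‖z‖ ^ ρ - ‖α‖ ^ ρ - inner ℝ g (z - α) := by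
    intro z
    by_cases h : z = α
    · simp [h]
    · exact (hg z h).le
  refine ⟨g, hg0, fun ε hε => ?_⟩
  have key : ∀ z, ε < ‖z - α‖ → ∃ w ∈ Metric.sphere α ε,
      ‖w‖ ^ ρ - ‖α‖ ^ ρ - inner ℝ g (w - α) ≤
        (ε / ‖z - α‖) * (‖z‖ ^ ρ - ‖α‖ ^ ρ - inner ℝ g (z - α)) := by
    intro z hz
    have hp : 0 < ‖z - α‖ := hε.trans hz
    set t := ε / ‖z - α‖ with ht
    have ht0 : 0 < t := div_pos hε hp
    have ht1 : t < 1 := (div_lt_one hp).2 hz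
    have hwe : t • z + (1 - t) • α - α = t • (z - α) := by module
    refine ⟨t • z + (1 - t) • α, ?_, ?_⟩
    · rw [mem_sphere_iff_norm, hwe, norm_smul, Real.norm_of_nonneg ht0.le, ht]
      field_simp
    · have := (aux_convex (E := E) ρ hρ).2 (mem_univ z) (mem_univ α) ht0.le (by linarith : 0 ≤ 1 - t)
        (by ring)
      simp only [smul_eq_mul] at this
      rw [hwe, inner_smul_right]
      linarith
  by_cases hne : (Metric.sphere α ε).Nonempty
  · have hcont : Continuous (fun z : E => ‖z‖ ^ ρ - ‖α‖ ^ ρ - inner ℝ g (z - α)) := by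
      have : Continuous (fun z : E => ‖z‖ ^ ρ) :=
        continuous_norm.rpow_const (fun _ => Or.inr (by linarith))
      fun_prop
    obtain ⟨w₀, hw₀, hmin⟩ := (isCompact_sphere α ε).exists_isMinOn hne hcont.continuousOn
    set m := ‖w₀‖ ^ ρ - ‖α‖ ^ ρ - inner ℝ g (w₀ - α) with hm
    have hmpos : 0 < m := hg w₀ (by
      rintro rfl
      simp at hw₀; linarith)
    refine ⟨ε / m, by positivity, fun z => ?_⟩
    rcases le_or_gt ‖z - α‖ ε with h | h
    · have := mul_nonneg (by positivity : 0 ≤ ε / m) (hg0 z)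
      linarith
    · obtain ⟨w, hw, hle⟩ := key z h
      have h1 : m ≤ _ := (hmin hw).trans hle
      have hp : 0 < ‖z - α‖ := hε.trans h
      have h2 := mul_le_mul_of_nonneg_left h1 (by positivity : 0 ≤ ‖z - α‖ / m)
      have h3 : ‖z - α‖ / m * m = ‖z - α‖ := by field_simp
      have h4 : ∀ X : ℝ, ‖z - α‖ / m * (ε / ‖z - α‖ * X) = ε / m * X := by
        intro X; field_simp
      rw [h3, h4] at h2
      linarith
  · refine ⟨0, le_rfl, fun z => ?_⟩
    by_contra hcon
    obtain ⟨w, hw, -⟩ := key z (by linarith)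
    exact hne ⟨w, hw⟩

theorem aux_int {E : Type*} [NormedAddCommGroup E] [NormedSpace ℝ E]
    [MeasurableSpace E] [BorelSpace E] [SecondCountableTopology E]
    {η ν : Measure E} [IsProbabilityMeasure η] [IsProbabilityMeasure ν]
    (h : ConvexOrder η ν) (hν : Integrable (fun x : E => x) ν) :
    Integrable (fun x : E => x) η := by
  refine ⟨aestronglyMeasurable_id, ?_⟩
  have h1 := h.1 (fun x => ‖x‖) convexOn_univ_norm (fun x => norm_nonneg x)
  have h2 := hν.2
  rw [hasFiniteIntegral_iff_norm] at h2 ⊢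
  exact h1.trans_lt h2

theorem aux_mean {E : Type*} [NormedAddCommGroup E] [InnerProductSpace ℝ E]
    [MeasurableSpace E] [BorelSpace E] [SecondCountableTopology E]
    {η ν : Measure E} [IsProbabilityMeasure η] [IsProbabilityMeasure ν]
    (h : ConvexOrder η ν) (hν : Integrable (fun x : E => x) ν) (g : E) :
    ∫ x, inner ℝ g x ∂η = ∫ x, inner ℝ g x ∂ν := by
  have hη := aux_int h hν
  have hi : ∀ g : E, Integrable (fun x : E => inner ℝ g x) (η + ν) := fun g =>
    (hη.const_inner g).add_measure (hν.const_inner g)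
  have hc : ∀ g : E, ConvexOn ℝ univ (fun x : E => inner ℝ g x) := fun g =>
    (innerₛₗ ℝ g).convexOn convex_univ
  have h1 := h.2 _ (hc g) (hi g)
  have h2 := h.2 _ (hc (-g)) (hi (-g))
  simp only [inner_neg_left, integral_neg] at h2
  linarith

theorem aux_key {E : Type*} [NormedAddCommGroup E] [InnerProductSpace ℝ E]
    [FiniteDimensional ℝ E]
    [MeasurableSpace E] [BorelSpace E] (ρ : ℝ) (hρ : 1 < ρ) {μ η ν : Measure E}
    [IsProbabilityMeasure μ] [IsProbabilityMeasure η] [IsProbabilityMeasure ν]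
    (hμ : ConvexOrder μ ν) (hη : ConvexOrder η ν) (hν : Integrable (fun x : E => x) ν) (α : E) :
    ∀ ε > 0, ∃ C : ℝ, 0 ≤ C ∧ ∀ π : Measure (E × E),
      π.map Prod.fst = μ.map (fun x => x + α) → π.map Prod.snd = η →
      ∫⁻ p, ENNReal.ofReal (‖p.1 - p.2‖ ^ ρ) ∂π ≠ ∞ →
      Integrable (fun p => ‖p.1 - p.2 - α‖) π ∧
      ‖α‖ ^ ρ ≤ (∫⁻ p, ENNReal.ofReal (‖p.1 - p.2‖ ^ ρ) ∂π).toReal ∧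
      ∫ p, ‖p.1 - p.2 - α‖ ∂π ≤
        ε + C * ((∫⁻ p, ENNReal.ofReal (‖p.1 - p.2‖ ^ ρ) ∂π).toReal - ‖α‖ ^ ρ) := by
  obtain ⟨g, hg0, hg⟩ := aux_quant ρ hρ α
  intro ε hε
  obtain ⟨C, hC, hq⟩ := hg ε hε
  refine ⟨C, hC, fun π h1 h2 hfin => ?_⟩
  have : IsProbabilityMeasure (μ.map (fun x => x + α)) :=
    Measure.isProbabilityMeasure_map (by fun_prop)
  have : IsProbabilityMeasure (π.map Prod.fst) := by rw [h1]; infer_instance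
  have : IsProbabilityMeasure π := Measure.isProbabilityMeasure_of_map (Prod.fst : E × E → E)
  have hmi := aux_int hμ hν
  have hei := aux_int hη hν
  have i1' : Integrable (fun x : E => x) (μ.map (fun x => x + α)) := by
    rw [integrable_map_measure (by fun_prop) (by fun_prop)]
    exact hmi.add (integrable_const α)
  have i1 : Integrable (fun p : E × E => p.1) π := by
    rw [← h1, integrable_map_measure (by fun_prop) (by fun_prop)] at i1'
    exact i1'
  have i2 : Integrable (fun p : E × E => p.2) π := by
    rw [← h2, integrable_map_measure (by fun_prop) (by fun_prop)] at hei
    exact hei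
  have iz : Integrable (fun p : E × E => p.1 - p.2 - α) π :=
    (i1.sub i2).sub (integrable_const α)
  have hcm : Measurable (fun p : E × E => ‖p.1 - p.2‖ ^ ρ) := by fun_prop
  have ic : Integrable (fun p : E × E => ‖p.1 - p.2‖ ^ ρ) π := by
    refine ⟨hcm.aestronglyMeasurable, ?_⟩
    rw [hasFiniteIntegral_iff_ofReal (Filter.Eventually.of_forall fun p => by positivity)]
    exact lt_top_iff_ne_top.2 hfin
  have hK : (∫⁻ p, ENNReal.ofReal (‖p.1 - p.2‖ ^ ρ) ∂π).toReal = ∫ p, ‖p.1 - p.2‖ ^ ρ ∂π := by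
    rw [integral_eq_lintegral_of_nonneg_ae (Filter.Eventually.of_forall fun p => by positivity)
      hcm.aestronglyMeasurable]
  have hmean : ∫ p, inner ℝ g (p.1 - p.2 - α) ∂π = 0 := by
    have e1 : ∫ p, inner ℝ g p.1 ∂π = ∫ x, inner ℝ g (x + α) ∂μ := by
      rw [← integral_map (φ := fun x => x + α) (f := fun x => inner ℝ g x) (by fun_prop)
        (by fun_prop), ← h1, integral_map (by fun_prop) (by fun_prop)]
    have e2 : ∫ p, inner ℝ g p.2 ∂π = ∫ x, inner ℝ g x ∂η := by
      rw [← h2, integral_map (by fun_prop) (by fun_prop)]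
    have e3 : ∫ x, inner ℝ g (x + α) ∂μ = ∫ x, inner ℝ g x ∂μ + inner ℝ g α := by
      simp_rw [inner_add_right]
      rw [integral_add (hmi.const_inner g) (integrable_const _)]
      simp
    have j1 : Integrable (fun p : E × E => inner ℝ g p.1) π := i1.const_inner g
    have j2 : Integrable (fun p : E × E => inner ℝ g p.2) π := i2.const_inner g
    have j3 : Integrable (fun p : E × E => inner ℝ g p.1 - inner ℝ g p.2) π := j1.sub j2
    simp_rw [inner_sub_right]
    rw [integral_sub j3 (integrable_const _), integral_sub j1 j2, e1, e2, e3, aux_mean hμ hν,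
      aux_mean hη hν]
    simp
  have ih : Integrable (fun p : E × E =>
      ‖p.1 - p.2‖ ^ ρ - ‖α‖ ^ ρ - inner ℝ g (p.1 - p.2 - α)) π :=
    (ic.sub (integrable_const _)).sub (iz.const_inner g)
  have hh : ∫ p, (‖p.1 - p.2‖ ^ ρ - ‖α‖ ^ ρ - inner ℝ g (p.1 - p.2 - α)) ∂π
      = ∫ p, ‖p.1 - p.2‖ ^ ρ ∂π - ‖α‖ ^ ρ := by
    have j1 : Integrable (fun p : E × E => ‖p.1 - p.2‖ ^ ρ - ‖α‖ ^ ρ) π :=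
      ic.sub (integrable_const _)
    rw [integral_sub j1 (iz.const_inner g), hmean,
      integral_sub ic (integrable_const _)]
    simp
  refine ⟨iz.norm, ?_, ?_⟩
  · have : 0 ≤ ∫ p, (‖p.1 - p.2‖ ^ ρ - ‖α‖ ^ ρ - inner ℝ g (p.1 - p.2 - α)) ∂π :=
      integral_nonneg fun p => hg0 (p.1 - p.2)
    rw [hK]; linarith
  · rw [hK, ← hh]
    calc _ ≤ ∫ p, (ε + C * (‖p.1 - p.2‖ ^ ρ - ‖α‖ ^ ρ - inner ℝ g (p.1 - p.2 - α))) ∂π :=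
          integral_mono iz.norm ((integrable_const _).add (ih.const_mul C))
            (fun p => hq (p.1 - p.2))
      _ = _ := by
          rw [integral_add (integrable_const _) (ih.const_mul C), integral_const_mul]
          simp

theorem aux_lower {E : Type*} [NormedAddCommGroup E] [InnerProductSpace ℝ E]
    [FiniteDimensional ℝ E]
    [MeasurableSpace E] [BorelSpace E] (ρ : ℝ) (hρ : 1 < ρ) {μ η ν : Measure E}
    [IsProbabilityMeasure μ] [IsProbabilityMeasure η] [IsProbabilityMeasure ν]
    (hμ : ConvexOrder μ ν) (hη : ConvexOrder η ν) (hν : Integrable (fun x : E => x) ν) (α : E) :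
    ENNReal.ofReal (‖α‖ ^ ρ) ≤ Wp ρ (μ.map (fun x => x + α)) η := by
  obtain ⟨C, -, h⟩ := aux_key ρ hρ hμ hη hν α 1 one_pos
  refine le_iInf fun π => le_iInf fun h1 => le_iInf fun h2 => ?_
  by_cases hf : ∫⁻ p, ENNReal.ofReal (‖p.1 - p.2‖ ^ ρ) ∂π = ∞
  · rw [hf]; exact le_top
  · exact ENNReal.ofReal_le_of_le_toReal (h π h1 h2 hf).2.1

theorem aux_exp (a b : ℝ) :
    ‖Complex.exp (a * Complex.I) - Complex.exp (b * Complex.I)‖ ≤ |a - b| := by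
  have : Complex.exp (a * Complex.I) - Complex.exp (b * Complex.I)
      = Complex.exp (b * Complex.I) * (Complex.exp (Complex.I * ((a - b : ℝ) : ℂ)) - 1) := by
    rw [mul_sub, ← Complex.exp_add]
    push_cast
    ring_nf
  rw [this, norm_mul, Complex.norm_exp_ofReal_mul_I, one_mul]
  exact Real.norm_exp_I_mul_ofReal_sub_one_le

theorem aux_unique {E : Type*} [NormedAddCommGroup E] [InnerProductSpace ℝ E]
    [FiniteDimensional ℝ E]
    [MeasurableSpace E] [BorelSpace E] (ρ : ℝ) (hρ : 1 < ρ) {μ η ν : Measure E}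
    [IsProbabilityMeasure μ] [IsProbabilityMeasure η] [IsProbabilityMeasure ν]
    (hμ : ConvexOrder μ ν) (hη : ConvexOrder η ν) (hν : Integrable (fun x : E => x) ν) (α : E)
    (hW : Wp ρ (μ.map (fun x => x + α)) η = ENNReal.ofReal (‖α‖ ^ ρ)) : η = μ := by
  have : CompleteSpace E := FiniteDimensional.complete ℝ E
  refine Measure.ext_of_charFun (funext fun t => ?_)
  rw [← sub_eq_zero, ← norm_le_zero_iff]
  refine le_of_forall_pos_le_add fun δ hδ => ?_
  rw [zero_add]
  obtain ⟨ε, hε, hεδ⟩ : ∃ ε > 0, ‖t‖ * (2 * ε) ≤ δ := by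
    refine ⟨δ / (2 * (‖t‖ + 1)), by positivity, ?_⟩
    have : 0 ≤ ‖t‖ := norm_nonneg t
    rw [show ‖t‖ * (2 * (δ / (2 * (‖t‖ + 1)))) = δ * ‖t‖ / (‖t‖ + 1) by field_simp,
      div_le_iff₀ (by positivity)]
    nlinarith
  obtain ⟨C, hC, h⟩ := aux_key ρ hρ hμ hη hν α ε hε
  have hlt : Wp ρ (μ.map (fun x => x + α)) η < ENNReal.ofReal (‖α‖ ^ ρ + ε / (C + 1)) := by
    rw [hW]
    have : 0 < ε / (C + 1) := by positivity
    exact (ENNReal.ofReal_lt_ofReal_iff (by positivity)).2 (by linarith)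
  simp only [Wp, iInf_lt_iff] at hlt
  obtain ⟨π, h1, h2, hlt⟩ := hlt
  obtain ⟨hi, -, hle⟩ := h π h1 h2 (hlt.trans ENNReal.ofReal_lt_top).ne
  have hK := (ENNReal.toReal_mono ENNReal.ofReal_ne_top hlt.le)
  rw [ENNReal.toReal_ofReal (by positivity)] at hK
  have hle2 : ∫ p, ‖p.1 - p.2 - α‖ ∂π ≤ 2 * ε := by
    have a1 := mul_le_mul_of_nonneg_left (sub_le_iff_le_add'.2 hK) hC
    have a2 : C * (ε / (C + 1)) ≤ ε := by
      rw [← mul_div_assoc, div_le_iff₀ (by positivity)]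
      nlinarith
    linarith
  have : IsProbabilityMeasure (μ.map (fun x => x + α)) :=
    Measure.isProbabilityMeasure_map (by fun_prop)
  have : IsProbabilityMeasure (π.map Prod.fst) := by rw [h1]; infer_instance
  have : IsProbabilityMeasure π := Measure.isProbabilityMeasure_of_map (Prod.fst : E × E → E)
  have c1 : charFun η t = ∫ p : E × E, Complex.exp ((inner ℝ p.2 t : ℝ) * Complex.I) ∂π := by
    rw [charFun_apply, ← h2, integral_map (by fun_prop) (by fun_prop)]
  have c2 : charFun μ t = ∫ p : E × E, Complex.exp ((inner ℝ (p.1 - α) t : ℝ) * Complex.I) ∂π := by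
    rw [charFun_apply]
    have : ∫ p : E × E, Complex.exp ((inner ℝ (p.1 - α) t : ℝ) * Complex.I) ∂π
      = ∫ x, Complex.exp ((inner ℝ (x - α) t : ℝ) * Complex.I) ∂(π.map Prod.fst) := by
      rw [integral_map (by fun_prop) (by fun_prop)]
    rw [this, h1, integral_map (by fun_prop) (by fun_prop)]
    simp
  have ie : ∀ f : E × E → ℝ, Continuous f →
      Integrable (fun p => Complex.exp ((f p : ℝ) * Complex.I)) π := by
    intro f hf
    refine Integrable.of_bound (C := 1) (by fun_prop) (Filter.Eventually.of_forall fun p => ?_)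
    rw [Complex.norm_exp_ofReal_mul_I]
  rw [c1, c2, ← integral_sub (ie _ (by fun_prop)) (ie _ (by fun_prop))]
  refine (norm_integral_le_of_norm_le (hi.const_mul ‖t‖)
    (Filter.Eventually.of_forall fun p => ?_)).trans ?_
  · refine (aux_exp _ _).trans ?_
    rw [← inner_sub_left, mul_comm]
    refine (abs_real_inner_le_norm _ _).trans (le_of_eq ?_)
    rw [← norm_neg]
    congr 2
    abel
  · rw [integral_const_mul]
    exact (mul_le_mul_of_nonneg_left hle2 (norm_nonneg t)).trans hεδ

/-- if `ρ > 1`, `μ ≤cx ν`, `ν ∈ P_ρ(ℝ^d)` and `μ^α` is the image of `μ` by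
`x ↦ x + α`, then `inf {W_ρ(μ^α,η)^ρ : η ≤cx ν} = |α|^ρ`, and `μ` is the unique probability
measure `η ≤cx ν` attaining this infimum, i.e. the `W_ρ`-projection of `μ^α` on
`{η : η ≤cx ν}` is `μ`. -/
theorem stmt4 {d : ℕ} (ρ : ℝ) (hρ : 1 < ρ)
    (μ ν : Measure (EuclideanSpace ℝ (Fin d)))
    [IsProbabilityMeasure μ] [IsProbabilityMeasure ν]
    (hcx : ConvexOrder μ ν) (hνρ : Integrable (fun x => ‖x‖ ^ ρ) ν)
    (α : EuclideanSpace ℝ (Fin d)) :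
    let μα := μ.map (fun x => x + α)
    ((⨅ (η : Measure (EuclideanSpace ℝ (Fin d))) (_ : IsProbabilityMeasure η)
        (_ : ConvexOrder η ν), Wp ρ μα η) = ENNReal.ofReal (‖α‖ ^ ρ))
    ∧ Wp ρ μα μ = ENNReal.ofReal (‖α‖ ^ ρ)
    ∧ (∀ η : Measure (EuclideanSpace ℝ (Fin d)), IsProbabilityMeasure η → ConvexOrder η ν →
        Wp ρ μα η = ENNReal.ofReal (‖α‖ ^ ρ) → η = μ) := by
  intro μα
  have hν : Integrable (fun x : EuclideanSpace ℝ (Fin d) => x) ν := by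
    refine Integrable.mono' ((integrable_const (1 : ℝ)).add hνρ) aestronglyMeasurable_id
      (Filter.Eventually.of_forall fun x => ?_)
    simp only [Pi.add_apply]
    rcases le_total ‖x‖ 1 with h | h
    · have : 0 ≤ ‖x‖ ^ ρ := by positivity
      linarith
    · have := Real.rpow_le_rpow_of_exponent_le h hρ.le
      rw [Real.rpow_one] at this
      linarith
  have hup : Wp ρ μα μ ≤ ENNReal.ofReal (‖α‖ ^ ρ) := by
    refine (iInf_le _ (μ.map (fun x => (x + α, x)))).trans ?_
    refine (iInf_le _ ?_).trans ((iInf_le _ ?_).trans ?_)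
    · rw [Measure.map_map (by fun_prop) (by fun_prop)]; rfl
    · rw [Measure.map_map (by fun_prop) (by fun_prop)]
      exact Measure.map_id
    · rw [lintegral_map (by fun_prop) (by fun_prop)]
      simp
  have hWμ : Wp ρ μα μ = ENNReal.ofReal (‖α‖ ^ ρ) :=
    le_antisymm hup (aux_lower ρ hρ hcx hcx hν α)
  refine ⟨le_antisymm ?_ ?_, hWμ, ?_⟩
  · exact (iInf_le _ μ).trans ((iInf_le _ ‹IsProbabilityMeasure μ›).trans ((iInf_le _ hcx).trans hup))
  · refine le_iInf fun η => le_iInf fun hp => le_iInf fun hη => ?_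
    exact aux_lower ρ hρ hcx hη hν α
  · intro η hp hη hW
    exact aux_unique ρ hρ hcx hη hν α hW
end
end
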